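/- Let r ≥ 2 be an integer and α ≥ 0 a real number. Then lim_{n→∞} n^{r+1/2}·(−1)^r·Δ^r log r_α(n) = π·(1/2)_r. -/

import Mathlib

open Real Filter

/-- The overpartition function. -/
noncomputable def pbar (n : ℕ) : ℕ :=
  ∑ k ∈ Finset.range (n + 1),
    (Nat.Partition.distincts k).card * Fintype.card (Nat.Partition (n - k))

/-- `r_α(n) = (p̄(n)/n^α)^(1/n)`. -/
noncomputable def rseq (α : ℝ) (n : ℕ) : ℝ :=
  ((pbar n : ℝ) / (n : ℝ) ^ α) ^ ((n : ℝ)⁻¹)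

/-- Forward difference operator. -/
noncomputable def fdiff (f : ℕ → ℝ) : ℕ → ℝ := fun n => f (n + 1) - f n

namespace Overpartition

open PowerSeries in
/-- The complex power series `φ` converges to `g` on the open disc of radius `R`. -/
def HasSumOnDisc (φ : PowerSeries ℂ) (g : ℂ → ℂ) (R : ℝ) : Prop :=
  ∀ q : ℂ, ‖q‖ < R → HasSum (fun n ↦ coeff n φ * q ^ n) (g q)

theorem HasSumOnDisc.mono {φ : PowerSeries ℂ} {g : ℂ → ℂ} {R R' : ℝ} (h : HasSumOnDisc φ g R)
    (hR : R' ≤ R) : HasSumOnDisc φ g R' :=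
  fun q hq ↦ h q (hq.trans_le hR)

theorem HasSumOnDisc.mul {φ ψ : PowerSeries ℂ} {f g : ℂ → ℂ} {R : ℝ} (hφ : HasSumOnDisc φ f R)
    (hψ : HasSumOnDisc ψ g R) : HasSumOnDisc (φ * ψ) (fun q ↦ f q * g q) R := by
  intro q hq
  have h1 := hφ q hq
  have h2 := hψ q hq
  have n1 := h1.summable.norm
  have n2 := h2.summable.norm
  have hs := (summable_norm_sum_mul_antidiagonal_of_summable_norm n1 n2).of_norm
  have key := tsum_mul_tsum_eq_tsum_sum_antidiagonal_of_summable_norm n1 n2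
  rw [h1.tsum_eq, h2.tsum_eq] at key
  simp only [key]
  convert! hs.hasSum using 2 with n
  rw [PowerSeries.coeff_mul, Finset.sum_mul]
  refine Finset.sum_congr rfl fun kl hkl ↦ ?_
  rw [← Finset.HasAntidiagonal.mem_antidiagonal.mp hkl, pow_add]
  ring

theorem HasSumOnDisc.hasFPowerSeriesOnBall {φ : PowerSeries ℂ} {g : ℂ → ℂ} {R : ℝ} (hR : 0 < R)
    (h : HasSumOnDisc φ g R) :
    HasFPowerSeriesOnBall g (FormalMultilinearSeries.ofScalars ℂ (fun n ↦ PowerSeries.coeff n φ)) 0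
      (ENNReal.ofReal R) := by
  refine ⟨?_, by simpa using hR, ?_⟩
  · refine ENNReal.le_of_forall_nnreal_lt fun r hr ↦ ?_
    have hr' : (r : ℝ) < R := by
      rw [← ENNReal.ofReal_coe_nnreal, ENNReal.ofReal_lt_ofReal_iff hR] at hr
      exact hr
    refine FormalMultilinearSeries.le_radius_of_summable _ ?_
    have := (h (r : ℂ) (by simpa using hr')).summable.norm
    simpa [FormalMultilinearSeries.ofScalars_norm] using this
  · intro y hy
    have hy' : ‖y‖ < R := by
      rw [Metric.mem_eball, edist_zero_right, ← ofReal_norm] at hy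
      exact (ENNReal.ofReal_lt_ofReal_iff hR).mp hy
    have := h y hy'
    simpa [FormalMultilinearSeries.ofScalars_apply_eq, mul_comm] using this

theorem HasSumOnDisc.unique {φ ψ : PowerSeries ℂ} {g : ℂ → ℂ} {R : ℝ} (hR : 0 < R)
    (hφ : HasSumOnDisc φ g R) (hψ : HasSumOnDisc ψ g R) : φ = ψ := by
  have := (hφ.hasFPowerSeriesOnBall hR).hasFPowerSeriesAt.eq_formalMultilinearSeries
    (hψ.hasFPowerSeriesOnBall hR).hasFPowerSeriesAt
  ext n
  simpa using congr_arg (FormalMultilinearSeries.coeff · n) this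

theorem tendstoLocallyUniformlyOn_iteratedDeriv {ι : Type*} {l : Filter ι} {F : ι → ℂ → ℂ}
    {f : ℂ → ℂ} {U : Set ℂ} (hU : IsOpen U) (hF : ∀ i, Differentiable ℂ (F i))
    (h : TendstoLocallyUniformlyOn F f l U) (n : ℕ) :
    TendstoLocallyUniformlyOn (fun i ↦ iteratedDeriv n (F i)) (iteratedDeriv n f) l U := by
  induction n with
  | zero => simpa using h
  | succ n ih =>
    simp_rw [iteratedDeriv_succ]
    refine ih.deriv (.of_forall fun i ↦ ?_) hU
    exact ((hF i).contDiff.differentiable_iteratedDeriv n (by exact_mod_cast WithTop.coe_lt_top _)).differentiableOn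

theorem iteratedDeriv_polynomial_zero (p : Polynomial ℂ) (n : ℕ) :
    iteratedDeriv n (fun q ↦ p.eval q) 0 = n.factorial * p.coeff n := by
  have h (n : ℕ) :
      iteratedDeriv n (fun q ↦ p.eval q) = fun q ↦ (Polynomial.derivative^[n] p).eval q := by
    induction n with
    | zero => simp
    | succ n ih =>
      ext q
      rw [iteratedDeriv_succ, ih, Polynomial.deriv, Function.iterate_succ_apply']
  rw [h]
  simp only
  rw [← Polynomial.coeff_zero_eq_eval_zero, Polynomial.coeff_iterate_derivative]
  simp [Nat.descFactorial_self]

theorem hasSumOnDisc_of_tendsto {ι : Type*} {l : Filter ι} [l.NeBot] {p : ι → Polynomial ℂ}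
    {φ : PowerSeries ℂ} {g : ℂ → ℂ}
    (h1 : ∀ n, Tendsto (fun i ↦ (p i).coeff n) l (nhds (PowerSeries.coeff n φ)))
    (h2 : TendstoLocallyUniformlyOn (fun i q ↦ (p i).eval q) g l (Metric.ball 0 1)) :
    HasSumOnDisc φ g 1 := by
  have hd (i : ι) : Differentiable ℂ (fun q ↦ (p i).eval q) := (p i).differentiable
  have hg : DifferentiableOn ℂ g (Metric.ball 0 1) :=
    h2.differentiableOn (.of_forall fun i ↦ (hd i).differentiableOn) Metric.isOpen_ball
  intro q hq
  have := Complex.hasSum_taylorSeries_on_ball hg (show q ∈ Metric.ball 0 1 by simpa using hq)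
  convert! this using 2 with n
  have h3 := ((tendstoLocallyUniformlyOn_iteratedDeriv Metric.isOpen_ball hd h2 n).tendsto_at
    (Metric.mem_ball_self one_pos))
  simp_rw [iteratedDeriv_polynomial_zero] at h3
  have h4 := tendsto_nhds_unique h3 ((h1 n).const_mul _)
  rw [h4]
  have : (n.factorial : ℂ) ≠ 0 := by exact_mod_cast n.factorial_ne_zero
  simp
  field_simp

/-- Euler's function `∏ (1 - q ^ (n + 1))`. -/
noncomputable def euler (q : ℂ) : ℂ := ∏' n : ℕ, (1 - q ^ (n + 1))

theorem hasProdLocallyUniformlyOn_one_add_mul_pow (ε : ℂ) (hε : ‖ε‖ = 1) :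
    HasProdLocallyUniformlyOn (fun (n : ℕ) q ↦ 1 + ε * q ^ (n + 1))
      (fun q ↦ ∏' n : ℕ, (1 + ε * q ^ (n + 1))) (Metric.ball (0 : ℂ) 1) := by
  apply hasProdLocallyUniformlyOn_of_forall_compact Metric.isOpen_ball
  intro K hK hcK
  rcases K.eq_empty_or_nonempty with hN | hN
  · simpa [hasProdUniformlyOn_iff_tendstoUniformlyOn, hN] using tendstoUniformlyOn_empty
  · obtain ⟨q₀, hq₀, _, HB⟩ := hcK.exists_sSup_image_eq_and_ge hN
      (show ContinuousOn (fun q : ℂ ↦ ‖q‖) K by fun_prop)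
    refine ((summable_nat_add_iff 1).mpr (summable_geometric_of_lt_one (norm_nonneg _)
      (by simpa [Metric.mem_ball, dist_zero_right] using hK hq₀))).hasProdUniformlyOn_nat_one_add
      hcK (.of_forall fun n x hx ↦ ?_) (fun _ ↦ by fun_prop)
    simpa [hε] using pow_le_pow_left₀ (norm_nonneg _) (HB x hx) (n + 1)

open PowerSeries PowerSeries.WithPiTopology in
theorem hasSumOnDisc_tprod {φ : PowerSeries ℂ} {ε : ℂ} (hε : ‖ε‖ = 1)
    (hφ : HasProd (fun n : ℕ ↦ 1 + C ε * X ^ (n + 1)) φ) :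
    HasSumOnDisc φ (fun q ↦ ∏' n : ℕ, (1 + ε * q ^ (n + 1))) 1 := by
  refine hasSumOnDisc_of_tendsto (l := (atTop : Filter (Finset ℕ)))
    (p := fun s ↦ ∏ i ∈ s, (1 + Polynomial.C ε * Polynomial.X ^ (i + 1))) (fun n ↦ ?_) ?_
  · have := (WithPiTopology.tendsto_iff_coeff_tendsto ..).mp hφ n
    refine this.congr fun s ↦ ?_
    rw [← Polynomial.coeff_coe]
    congr 1
    rw [← Polynomial.coeToPowerSeries.ringHom_apply, map_prod]
    simp
  · have := hasProdLocallyUniformlyOn_one_add_mul_pow ε hε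
    rw [hasProdLocallyUniformlyOn_iff_tendstoLocallyUniformlyOn] at this
    simpa [Polynomial.eval_prod] using this

/-- The generating function of overpartitions as an analytic function on the unit disc. -/
noncomputable def gen (q : ℂ) : ℂ := euler (q ^ 2) / euler q ^ 2

theorem multipliable_one_add_mul_pow {ε q : ℂ} (hε : ‖ε‖ = 1) (hq : ‖q‖ < 1) :
    Multipliable fun n : ℕ ↦ 1 + ε * q ^ (n + 1) := by
  apply multipliable_one_add_of_summable (f := fun n ↦ ε * q ^ (n + 1))
  simpa [hε] using (summable_nat_add_iff 1).mpr (summable_geometric_of_lt_one (norm_nonneg _) hq)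

theorem norm_pow_succ_lt_one {q : ℂ} (hq : ‖q‖ < 1) (n : ℕ) : ‖q ^ (n + 1)‖ < 1 := by
  rw [norm_pow]
  exact pow_lt_one₀ (norm_nonneg _) hq (by simp)

theorem euler_ne_zero {q : ℂ} (hq : ‖q‖ < 1) : euler q ≠ 0 := by
  have := tprod_one_add_ne_zero_of_summable (f := fun n : ℕ ↦ -q ^ (n + 1)) (fun i h ↦ ?_) ?_
  · simpa [euler, sub_eq_add_neg] using this
  · have h2 : q ^ (i + 1) = 1 := by linear_combination -h
    have := norm_pow_succ_lt_one hq i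
    rw [h2] at this
    simp at this
  · simpa using (summable_nat_add_iff 1).mpr (summable_geometric_of_lt_one (norm_nonneg _) hq)

theorem euler_sq {q : ℂ} (hq : ‖q‖ < 1) :
    euler (q ^ 2) = euler q * ∏' n : ℕ, (1 + 1 * q ^ (n + 1)) := by
  rw [euler, euler, ← (ModularForm.multipliable_one_sub_pow hq).tprod_mul
    (multipliable_one_add_mul_pow (by simp) hq)]
  refine tprod_congr fun n ↦ ?_
  ring

theorem differentiableOn_gen : DifferentiableOn ℂ gen (Metric.ball 0 1) := by
  have h := ModularForm.differentiableOn_tprod_one_sub_pow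
  refine DifferentiableOn.div ?_ (h.pow 2) fun q hq ↦ pow_ne_zero 2 (euler_ne_zero (by simpa using hq))
  refine h.comp (by fun_prop) fun q hq ↦ ?_
  simpa using norm_pow_succ_lt_one (by simpa using hq) 1

open PowerSeries PowerSeries.WithPiTopology in
theorem mk_card_partition_mul :
    PowerSeries.mk (fun n ↦ (Fintype.card (Nat.Partition n) : ℂ)) * ∏' i : ℕ, (1 - X ^ (i + 1)) = 1 := by
  have h := Nat.Partition.powerSeriesMk_card_restricted_eq_tprod ℂ (fun _ ↦ True)
  have h0 : (fun n ↦ (Fintype.card (Nat.Partition n) : ℂ)) =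
      fun n ↦ ((Nat.Partition.restricted n (fun _ ↦ True)).card : ℂ) := by
    ext n
    simp [Nat.Partition.restricted]
  rw [h0, h, ← (Nat.Partition.multipliable_powerSeriesMk_card_restricted ℂ (fun _ ↦ True)).tprod_mul
    (multipliable_one_sub_X_pow _)]
  conv_rhs => rw [← tprod_one (L := .unconditional ℕ)]
  refine tprod_congr fun i ↦ ?_
  simp only [if_true, pow_mul]
  rw [tsum_pow_mul_one_sub_of_constantCoeff_eq_zero (by simp)]

open PowerSeries in
theorem mk_pbar : PowerSeries.mk (fun n ↦ (pbar n : ℂ)) =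
    PowerSeries.mk (fun n ↦ ((Nat.Partition.distincts n).card : ℂ)) *
      PowerSeries.mk (fun n ↦ (Fintype.card (Nat.Partition n) : ℂ)) := by
  ext n
  rw [coeff_mul, Finset.Nat.sum_antidiagonal_eq_sum_range_succ_mk]
  simp [pbar]

open PowerSeries PowerSeries.WithPiTopology in
theorem eq_mk_pbar {φ : PowerSeries ℂ} {R : ℝ} (hR : 0 < R) (hR1 : R ≤ 1)
    (h : HasSumOnDisc φ gen R) : φ = PowerSeries.mk (fun n ↦ (pbar n : ℂ)) := by
  have hE : HasSumOnDisc (∏' i : ℕ, (1 - X ^ (i + 1))) euler 1 := by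
    have := hasSumOnDisc_tprod (φ := ∏' i : ℕ, (1 - X ^ (i + 1))) (ε := -1) (by simp)
      (by simpa [← sub_eq_add_neg] using (multipliable_one_sub_X_pow ℂ).hasProd)
    simpa [euler, ← sub_eq_add_neg] using! this
  have hD : HasSumOnDisc (PowerSeries.mk (fun n ↦ ((Nat.Partition.distincts n).card : ℂ)))
      (fun q ↦ ∏' n : ℕ, (1 + 1 * q ^ (n + 1))) 1 := by
    refine hasSumOnDisc_tprod (by simp) ?_
    have := Nat.Partition.hasProd_powerSeriesMk_card_countRestricted ℂ two_pos
    simp only [Nat.Partition.countRestricted_two] at this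
    convert! this using 2 with i
    exact .symm ((Finset.sum_range_succ _ 1).trans (by simp))
  have key := HasSumOnDisc.unique (φ := φ * ∏' i : ℕ, (1 - X ^ (i + 1)))
    (ψ := PowerSeries.mk (fun n ↦ ((Nat.Partition.distincts n).card : ℂ)))
    (g := fun q ↦ gen q * euler q) hR (h.mul (hE.mono hR1)) fun q hq ↦ by
      have hq1 := hq.trans_le hR1
      have h2 : (∏' n : ℕ, (1 + 1 * q ^ (n + 1))) = gen q * euler q := by
        have := euler_ne_zero hq1
        rw [gen, euler_sq hq1]
        field_simp
      simpa only [h2] using hD q hq1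
  rw [mk_pbar, ← key, mul_assoc, mul_comm (∏' i : ℕ, _), mk_card_partition_mul, mul_one]

theorem pbar_eq_integral (n : ℕ) {y : ℝ} (hy : 0 < y) :
    (pbar n : ℂ) = (2 * π)⁻¹ * ∫ x in (-π)..π,
      gen (Complex.exp (-(y + x * Complex.I))) * Complex.exp (n * (y + x * Complex.I)) := by
  obtain ⟨R, hR⟩ : ∃ R : NNReal, (R : ℝ) = rexp (-y) := ⟨⟨rexp (-y), (exp_pos _).le⟩, rfl⟩
  have hRpos : 0 < R := by
    rw [← NNReal.coe_pos, hR]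
    exact exp_pos _
  have hR1 : (R : ℝ) < 1 := hR ▸ Real.exp_lt_one_iff.mpr (by linarith)
  have hsum := (differentiableOn_gen.mono (Metric.closedBall_subset_ball hR1)).hasFPowerSeriesOnBall
    hRpos
  have hpb := eq_mk_pbar
    (φ := PowerSeries.mk fun n ↦ cauchyPowerSeries gen 0 R n fun _ ↦ 1) (R := R) hRpos hR1.le
    fun q hq ↦ by
      have := hsum.hasSum (y := q) (by simpa using hq)
      rw [zero_add] at this
      convert! this using 2 with n
      rw [PowerSeries.coeff_mk, mul_comm, ← smul_eq_mul]
      conv_rhs => rw [show (fun _ : Fin n ↦ q) = fun _ ↦ q • (1 : ℂ) by simp]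
      rw [ContinuousMultilinearMap.map_smul_univ]
      simp
  have hn := congr_arg (PowerSeries.coeff n) hpb
  rw [PowerSeries.coeff_mk, PowerSeries.coeff_mk, cauchyPowerSeries_apply] at hn
  rw [← hn, circleIntegral_def_Icc, MeasureTheory.integral_Icc_eq_integral_Ioc,
    ← intervalIntegral.integral_of_le (by positivity)]
  set h : ℝ → ℂ := fun x ↦
    gen (Complex.exp (-(y + x * Complex.I))) * Complex.exp (n * (y + x * Complex.I)) with hh
  have hper : Function.Periodic h (2 * π) := by
    intro x
    simp only [hh]
    congr 1
    · congr 1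
      rw [Complex.exp_eq_exp_iff_exists_int]
      exact ⟨-1, by push_cast; ring⟩
    · rw [Complex.exp_eq_exp_iff_exists_int]
      exact ⟨n, by push_cast; ring⟩
  have h1 : ∫ x in (-π)..π, h x = ∫ x in 0..(2 * π), h (-x) := by
    rw [intervalIntegral.integral_comp_neg]
    have := hper.intervalIntegral_add_eq (-π) (-(2 * π))
    simpa [show -π + 2 * π = π by ring] using this
  rw [h1, smul_eq_mul, mul_inv, mul_comm _ Complex.I⁻¹, mul_assoc, mul_left_comm,
    ← intervalIntegral.integral_const_mul]
  congr 1
  · push_cast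
    ring
  refine intervalIntegral.integral_congr fun x _ ↦ ?_
  have hc : circleMap 0 R x = Complex.exp (-(y + (-x : ℝ) * Complex.I)) := by
    simp only [circleMap, hR, zero_add]
    rw [Complex.ofReal_exp, ← Complex.exp_add]
    congr 1
    push_cast
    ring
  have hc0 : Complex.exp (-(y + (-x : ℝ) * Complex.I)) ≠ 0 := Complex.exp_ne_zero _
  simp only [hh, sub_zero, smul_eq_mul, deriv_circleMap, hc]
  rw [show (n : ℂ) * (y + (-x : ℝ) * Complex.I) = n * (-(-(y + (-x : ℝ) * Complex.I))) by ring,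
    Complex.exp_nat_mul, Complex.exp_neg (-_)]
  field_simp

/-- The Dedekind eta function in the variable `z = -2πiτ`. -/
noncomputable def etaExp (z : ℂ) : ℂ := Complex.exp (-z / 24) * euler (Complex.exp (-z))

theorem norm_exp_neg_lt_one {z : ℂ} (hz : 0 < z.re) : ‖Complex.exp (-z)‖ < 1 := by
  rw [Complex.norm_exp, Real.exp_lt_one_iff]
  simpa using hz

theorem etaExp_ne_zero {z : ℂ} (hz : 0 < z.re) : etaExp z ≠ 0 :=
  mul_ne_zero (Complex.exp_ne_zero _) (euler_ne_zero (norm_exp_neg_lt_one hz))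

theorem etaExp_eq_eta (z : ℂ) : etaExp z = ModularForm.eta (Complex.I * (z / (2 * π))) := by
  have hπ : (π : ℂ) ≠ 0 := by exact_mod_cast pi_ne_zero
  have h : 2 * π * Complex.I * (Complex.I * (z / (2 * π))) = -z := by
    field_simp
    rw [Complex.I_sq]
    ring
  simp only [etaExp, ModularForm.eta, ModularForm.eta_q_eq_pow, Function.Periodic.qParam, euler, h]
  norm_num

theorem csqrt_I_mul {w : ℂ} (hw : 0 < w.re) :
    Complex.sqrt (Complex.I * w) = Complex.sqrt Complex.I * Complex.sqrt w := by
  have hw0 : w ≠ 0 := by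
    rintro rfl
    simp at hw
  have h := Complex.abs_arg_lt_pi_div_two_iff.mpr (Or.inl hw)
  rw [abs_lt] at h
  simp only [Complex.sqrt]
  rw [Complex.cpow_def_of_ne_zero (mul_ne_zero Complex.I_ne_zero hw0),
    Complex.cpow_def_of_ne_zero Complex.I_ne_zero, Complex.cpow_def_of_ne_zero hw0, ← Complex.exp_add,
    Complex.log_mul Complex.I_ne_zero hw0, add_mul]
  rw [Complex.arg_I]
  constructor <;> linarith

theorem csqrt_sq (w : ℂ) : Complex.sqrt w ^ 2 = w := by
  rw [Complex.sqrt, ← Complex.cpow_nat_mul]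
  simp

theorem re_inv_pos {z : ℂ} (hz : 0 < z.re) : 0 < (z⁻¹).re := by
  have hz0 : z ≠ 0 := by
    rintro rfl
    simp at hz
  rw [Complex.inv_re]
  exact div_pos hz (Complex.normSq_pos.mpr hz0)

theorem etaExp_inversion {z : ℂ} (hz : 0 < z.re) :
    etaExp (4 * π ^ 2 / z) = Complex.sqrt (z / (2 * π)) * etaExp z := by
  have hπ : (π : ℂ) ≠ 0 := by exact_mod_cast pi_ne_zero
  have hz0 : z ≠ 0 := by
    rintro rfl
    simp at hz
  have hre : 0 < (z / (2 * π)).re := by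
    rw [show (2 * π : ℂ) = ((2 * π : ℝ) : ℂ) by push_cast; ring, Complex.div_ofReal_re]
    positivity
  have hmem : Complex.I * (z / (2 * π)) ∈ UpperHalfPlane.upperHalfPlaneSet := by
    simpa using hre
  have key := ModularForm.eta_comp_eq_csqrt_I_inv hmem
  have h1 : (-1) / (Complex.I * (z / (2 * π))) = Complex.I * ((4 * π ^ 2 / z) / (2 * π)) := by
    field_simp
    rw [Complex.I_sq]
    ring
  simp only [Function.comp_apply, Pi.smul_apply, Pi.mul_apply, smul_eq_mul, h1, ← etaExp_eq_eta,
    csqrt_I_mul hre] at key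
  rw [key]
  have : Complex.sqrt Complex.I ≠ 0 := fun h ↦
    Complex.I_ne_zero (by simpa [h] using (csqrt_sq Complex.I).symm)
  field_simp

theorem gen_exp_eq (z : ℂ) : gen (Complex.exp (-z)) = etaExp (2 * z) / etaExp z ^ 2 := by
  rw [gen, etaExp, etaExp, mul_pow, ← Complex.exp_nat_mul, ← Complex.exp_nat_mul]
  rw [show ((2 : ℕ) : ℂ) * (-z / 24) = -(2 * z) / 24 by push_cast; ring, mul_div_mul_left _ _
    (Complex.exp_ne_zero _)]
  congr 3
  push_cast
  ring_nf

/-- The generating function of overpartitions after the modular inversion. -/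
noncomputable def genDual (q : ℂ) : ℂ := euler q / euler (q ^ 2) ^ 2

theorem gen_exp_eq_genDual {z : ℂ} (hz : 0 < z.re) :
    gen (Complex.exp (-z)) = Complex.sqrt (z / π) / 2 * Complex.exp (π ^ 2 / 4 / z) *
      genDual (Complex.exp (-(2 * π ^ 2 / z))) := by
  have hπ : (π : ℂ) ≠ 0 := by exact_mod_cast pi_ne_zero
  have hz0 : z ≠ 0 := by
    rintro rfl
    simp at hz
  have h1 := etaExp_inversion hz
  have h2 := etaExp_inversion (z := 2 * z) (by simpa using hz)
  rw [show 2 * z / (2 * π) = z / π by field_simp, show 4 * π ^ 2 / (2 * z) = 2 * π ^ 2 / z by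
    field_simp; norm_num] at h2
  have hs := csqrt_sq (z / π)
  have hs' := csqrt_sq (z / (2 * π))
  have hn : Complex.sqrt (z / π) ≠ 0 := fun h ↦ by
    rw [h] at hs
    field_simp at hs
    simp_all
  have hn0 := etaExp_ne_zero hz
  have hre : 0 < (4 * π ^ 2 / z).re := by
    have := re_inv_pos hz
    rw [div_eq_mul_inv, show (4 * π ^ 2 : ℂ) = ((4 * π ^ 2 : ℝ) : ℂ) by push_cast; ring,
      Complex.re_ofReal_mul]
    positivity
  have hn1 := etaExp_ne_zero hre
  have h3 : gen (Complex.exp (-z)) = Complex.sqrt (z / π) / 2 *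
      (etaExp (2 * π ^ 2 / z) / etaExp (4 * π ^ 2 / z) ^ 2) := by
    rw [gen_exp_eq, h1, h2, mul_pow, hs']
    field_simp
    rw [hs]
    field_simp
  rw [h3, mul_assoc]
  congr 1
  have h4 : 4 * π ^ 2 / z = 2 * (2 * π ^ 2 / z) := by ring
  rw [h4, etaExp, etaExp, genDual, mul_pow, ← Complex.exp_nat_mul (-(2 * (2 * π ^ 2 / z)) / 24),
    ← Complex.exp_nat_mul (-(2 * π ^ 2 / z)), mul_div_mul_comm, ← Complex.exp_sub]
  congr 3
  · push_cast
    ring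
  · push_cast
    ring_nf

theorem exists_norm_genDual_sub_one_le :
    ∃ C : ℝ, 0 < C ∧ ∀ᶠ q in nhds (0 : ℂ), ‖genDual q - 1‖ ≤ C * ‖q‖ := by
  have h := ModularForm.differentiableOn_tprod_one_sub_pow
  have h0 : euler 0 = 1 := by simp [euler]
  have hd : DifferentiableAt ℂ genDual 0 := by
    have hE : DifferentiableAt ℂ euler 0 := h.differentiableAt (Metric.ball_mem_nhds _ one_pos)
    refine hE.div (DifferentiableAt.pow (DifferentiableAt.comp (g := euler) 0 ?_ (by fun_prop)) 2) (by simp [h0])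
    simpa using hE
  obtain ⟨C, hC, hb⟩ := hd.isBigO_sub.exists_pos
  refine ⟨C, hC, ?_⟩
  simpa [genDual, h0] using hb.bound

theorem norm_one_add_div_one_sub_le {w : ℂ} (hw : ‖w‖ < 1) :
    ‖(1 + w) / (1 - w)‖ ≤
      ‖(1 + (‖w‖ : ℂ)) / (1 - (‖w‖ : ℂ))‖ * rexp (2 * (w.re - ‖w‖)) := by
  have hsum {v : ℂ} (hv : ‖v‖ < 1) : HasSum (fun n : ℕ ↦ ((v ^ n - (-v) ^ n) / n).re)
      (Real.log ‖(1 + v) / (1 - v)‖) := by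
    have h1 := Complex.hasSum_taylorSeries_neg_log hv
    have h2 := Complex.hasSum_taylorSeries_neg_log (z := -v) (by simpa using hv)
    have h3 := Complex.hasSum_re (h1.sub h2)
    have n1 : 1 - v ≠ 0 := by
      intro h
      rw [← sub_eq_zero.mp h] at hv
      simp at hv
    have n2 : 1 + v ≠ 0 := by
      intro h
      rw [← neg_eq_of_add_eq_zero_right h] at hv
      simp at hv
    rw [norm_div, Real.log_div (norm_ne_zero_iff.mpr n2) (norm_ne_zero_iff.mpr n1)]
    convert! h3 using 2 with n
    · rw [sub_div]
    · simp [Complex.log_re]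
      ring
  set s : ℂ := (‖w‖ : ℂ) with hs
  have hsn : ‖s‖ = ‖w‖ := by simp [hs]
  have hs1 : ‖s‖ < 1 := by rwa [hsn]
  have h := (hsum hs1).sub (hsum hw)
  have hnonneg (n : ℕ) : 0 ≤ ((s ^ n - (-s) ^ n) / n).re - ((w ^ n - (-w) ^ n) / n).re := by
    have e (v : ℂ) : ((v ^ n - (-v) ^ n) / n).re = (1 - (-1) ^ n) / n * (v ^ n).re := by
      rw [neg_pow v, ← one_sub_mul, mul_div_right_comm,
        show (1 - (-1) ^ n : ℂ) / n = (((1 - (-1) ^ n) / n : ℝ) : ℂ) by push_cast; ring,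
        Complex.re_ofReal_mul]
    rw [e, e, ← mul_sub]
    refine mul_nonneg (div_nonneg ?_ (Nat.cast_nonneg _)) ?_
    · rcases neg_one_pow_eq_or ℝ n with h | h <;> norm_num [h]
    · rw [hs, ← Complex.ofReal_pow, Complex.ofReal_re, ← norm_pow, sub_nonneg]
      exact Complex.re_le_norm _
  have h1 := le_hasSum h 1 fun n _ ↦ hnonneg n
  have n1 : ‖w‖ < 1 := hw
  have pos {v : ℂ} (hv : ‖v‖ < 1) : 0 < ‖(1 + v) / (1 - v)‖ := by
    refine norm_pos_iff.mpr (div_ne_zero ?_ ?_)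
    · intro h
      rw [← neg_eq_of_add_eq_zero_right h] at hv
      simp at hv
    · intro h
      rw [← sub_eq_zero.mp h] at hv
      simp at hv
  rw [← Real.exp_log (pos hw), ← Real.exp_log (pos hs1), ← Real.exp_add]
  apply Real.exp_le_exp.mpr
  have h2 (v : ℂ) : ((v ^ 1 - (-v) ^ 1) / (1 : ℕ)).re = 2 * v.re := by
    simp
    ring
  rw [h2, h2, hs, Complex.ofReal_re] at h1
  rw [hs]
  linarith

theorem tendsto_prod_gen {q : ℂ} (hq : ‖q‖ < 1) :
    Tendsto (fun N ↦ ∏ i ∈ Finset.range N, (1 + q ^ (i + 1)) / (1 - q ^ (i + 1))) atTop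
      (nhds (gen q)) := by
  have h1 := (multipliable_one_add_mul_pow (ε := 1) (by simp) hq).hasProd.tendsto_prod_nat
  have h2 := (ModularForm.multipliable_one_sub_pow hq).hasProd.tendsto_prod_nat
  have h0 := euler_ne_zero hq
  have h3 := h1.div h2 h0
  have h4 : gen q = (∏' n : ℕ, (1 + 1 * q ^ (n + 1))) / euler q := by
    rw [gen, euler_sq hq]
    field_simp
  rw [h4]
  refine h3.congr fun N ↦ ?_
  simp [Finset.prod_div_distrib]

theorem tendsto_geom_re {q : ℂ} (hq : ‖q‖ < 1) :
    Tendsto (fun N ↦ ∑ i ∈ Finset.range N, (q ^ (i + 1)).re) atTop (nhds (q / (1 - q)).re) := by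
  have h1 := (Complex.hasSum_re ((hasSum_geometric_of_norm_lt_one hq).mul_left q)).tendsto_sum_nat
  simpa [pow_succ', div_eq_mul_inv] using h1

theorem norm_gen_le {q : ℂ} (hq : ‖q‖ < 1) :
    ‖gen q‖ ≤ ‖gen ‖q‖‖ * rexp (2 * ((q / (1 - q)).re - ‖q‖ / (1 - ‖q‖))) := by
  have hr : ‖(‖q‖ : ℂ)‖ < 1 := by simpa using hq
  have h1 := (tendsto_prod_gen hq).norm
  have h2 := (tendsto_prod_gen hr).norm
  have h3 := ((tendsto_geom_re hq).sub (tendsto_geom_re hr)).const_mul 2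
  have h4 : (((‖q‖ : ℂ) / (1 - ‖q‖ : ℂ))).re = ‖q‖ / (1 - ‖q‖) := by
    rw [← Complex.ofReal_one, ← Complex.ofReal_sub, ← Complex.ofReal_div, Complex.ofReal_re]
  rw [h4] at h3
  refine le_of_tendsto_of_tendsto' h1 (h2.mul ((Real.continuous_exp.tendsto _).comp h3)) fun N ↦ ?_
  simp only [Function.comp_apply]
  rw [← Finset.sum_sub_distrib, Finset.mul_sum, Real.exp_sum, norm_prod, norm_prod,
    ← Finset.prod_mul_distrib]
  refine Finset.prod_le_prod (fun _ _ ↦ norm_nonneg _) fun i _ ↦ ?_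
  have := norm_one_add_div_one_sub_le (norm_pow_succ_lt_one hq i)
  rw [← Complex.ofReal_pow, Complex.ofReal_re]
  simpa only [norm_pow] using this

theorem sq_le_normSq_exp_sub_one {x y : ℝ} (hy : 0 < y) (hx : |x| ≤ π) :
    y ^ 2 + 4 / π ^ 2 * x ^ 2 ≤ ‖Complex.exp (y + x * Complex.I) - 1‖ ^ 2 := by
  have h1 := Real.add_one_le_exp y
  have h2 := Real.cos_le_one_sub_mul_cos_sq hx
  rw [← Complex.normSq_eq_norm_sq, Complex.normSq_apply]
  simp only [Complex.sub_re, Complex.sub_im, Complex.exp_re, Complex.exp_im, Complex.one_re,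
    Complex.one_im, sub_zero, Complex.add_re, Complex.add_im, Complex.ofReal_re, Complex.ofReal_im,
    Complex.re_ofReal_mul, Complex.im_ofReal_mul, Complex.I_re, Complex.I_im, mul_zero, mul_one,
    add_zero, zero_add]
  have h3 := Real.sin_sq_add_cos_sq x
  have h4 : (rexp y * cos x - 1) * (rexp y * cos x - 1) + rexp y * sin x * (rexp y * sin x) =
      (rexp y - 1) ^ 2 + rexp y * (2 * (1 - cos x)) := by
    linear_combination rexp y ^ 2 * h3
  rw [h4]
  have h5 : 4 / π ^ 2 * x ^ 2 ≤ 2 * (1 - cos x) := by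
    have : 4 / π ^ 2 * x ^ 2 = 2 * (2 / π ^ 2 * x ^ 2) := by ring
    linarith
  have h6 : 0 ≤ 4 / π ^ 2 * x ^ 2 := by positivity
  nlinarith

theorem norm_gen_exp_le {x y : ℝ} (hy : 0 < y) (hy1 : y < 1) (hx : |x| ≤ π)
    (hxy : 4 / 3 * y ≤ |x|) :
    ‖gen (Complex.exp (-(y + x * Complex.I)))‖ ≤
      ‖gen (Complex.exp (-(y : ℂ)))‖ * rexp (2 - 2 * (31 / 131) / y) := by
  set q := Complex.exp (-(y + x * Complex.I)) with hq
  have hn : ‖q‖ = rexp (-y) := by simp [hq, Complex.norm_exp]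
  have hq1 : ‖q‖ < 1 := by
    rw [hn, Real.exp_lt_one_iff]
    linarith
  have h := norm_gen_le hq1
  have hr : ((‖q‖ : ℝ) : ℂ) = Complex.exp (-(y : ℂ)) := by rw [hn]; simp
  rw [hr] at h
  refine h.trans (mul_le_mul_of_nonneg_left (Real.exp_le_exp.mpr ?_) (norm_nonneg _))
  have h1 : 1 / y - 1 ≤ ‖q‖ / (1 - ‖q‖) := by
    have h2 : 1 - y ≤ ‖q‖ := by
      rw [hn]
      linarith [Real.add_one_le_exp (-y)]
    rw [le_div_iff₀ (by linarith)]
    have h3 : 1 / y - 1 = (1 - y) / y := by field_simp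
    rw [h3, div_mul_eq_mul_div, div_le_iff₀ hy]
    nlinarith
  have h2 : (q / (1 - q)).re ≤ 100 / 131 / y := by
    refine (Complex.re_le_norm _).trans ?_
    have h3 : q / (1 - q) = (Complex.exp (y + x * Complex.I) - 1)⁻¹ := by
      rw [hq, Complex.exp_neg]
      have := Complex.exp_ne_zero (y + x * Complex.I)
      rw [div_eq_mul_inv, ← mul_inv]
      congr 1
      field_simp
    rw [h3, norm_inv]
    have h4 := sq_le_normSq_exp_sub_one hy hx
    have hx2 : 16 / 9 * y ^ 2 ≤ x ^ 2 := by
      rw [← sq_abs x]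
      nlinarith
    have hπ : 0.405 ≤ 4 / π ^ 2 := by
      rw [le_div_iff₀ (by positivity)]
      nlinarith [Real.pi_lt_d4, Real.pi_gt_three]
    have h5 : (131 / 100 * y) ^ 2 ≤ ‖Complex.exp (y + x * Complex.I) - 1‖ ^ 2 := by
      have : 0.405 * (16 / 9 * y ^ 2) ≤ 4 / π ^ 2 * x ^ 2 := by gcongr
      nlinarith [sq_nonneg y]
    have h6 := le_of_sq_le_sq h5 (norm_nonneg _)
    calc _ ≤ (131 / 100 * y)⁻¹ := inv_anti₀ (by positivity) h6
      _ = _ := by field_simp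
  have h3 : 2 * (31 / 131) / y = 2 * (1 / y - 100 / 131 / y) := by ring
  linarith

theorem norm_sqrt_div_pi_le_one {z : ℂ} (hz : ‖z‖ ≤ 1) : ‖Complex.sqrt (z / π)‖ ≤ 1 := by
  have h1 : ‖Complex.sqrt (z / π)‖ ^ 2 ≤ 1 := by
    rw [← norm_pow, csqrt_sq, norm_div, Complex.norm_real, Real.norm_of_nonneg pi_pos.le,
      div_le_one pi_pos]
    linarith [Real.pi_gt_three]
  nlinarith [norm_nonneg (Complex.sqrt (z / π))]

theorem exists_norm_gen_sub_le : ∃ C T : ℝ, 0 < C ∧ 0 < T ∧ ∀ z : ℂ, 0 < z.re → ‖z‖ ≤ 1 → T ≤ (z⁻¹).re →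
    ‖gen (Complex.exp (-z)) - Complex.sqrt (z / π) / 2 * Complex.exp (π ^ 2 / 4 / z)‖ ≤ C := by
  obtain ⟨C, hC, h⟩ := exists_norm_genDual_sub_one_le
  obtain ⟨ε, hε, hb⟩ := Metric.eventually_nhds_iff.mp h
  refine ⟨C, ε⁻¹, hC, inv_pos.mpr hε, fun z hz hz1 hT ↦ ?_⟩
  have hinv : 0 < (z⁻¹).re := re_inv_pos hz
  have hQ : ‖Complex.exp (-(2 * π ^ 2 / z))‖ = rexp (-(2 * π ^ 2 * (z⁻¹).re)) := by
    rw [Complex.norm_exp, Complex.neg_re, div_eq_mul_inv,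
      show (2 * π ^ 2 : ℂ) = ((2 * π ^ 2 : ℝ) : ℂ) by push_cast; ring, Complex.re_ofReal_mul]
  have hA : ‖Complex.exp (π ^ 2 / 4 / z)‖ = rexp (π ^ 2 / 4 * (z⁻¹).re) := by
    rw [Complex.norm_exp, div_eq_mul_inv,
      show (π ^ 2 / 4 : ℂ) = ((π ^ 2 / 4 : ℝ) : ℂ) by push_cast; ring, Complex.re_ofReal_mul]
  have hπ := Real.pi_gt_three
  have hS := norm_sqrt_div_pi_le_one hz1
  have hsmall : ‖Complex.exp (-(2 * π ^ 2 / z))‖ < ε := by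
    rw [hQ, Real.exp_neg]
    refine inv_lt_of_inv_lt₀ hε ?_
    have h1 := Real.add_one_le_exp (2 * π ^ 2 * (z⁻¹).re)
    have h2 : 1 ≤ 2 * π ^ 2 := by nlinarith
    have h3 := mul_le_mul_of_nonneg_right h2 hinv.le
    linarith
  have hG := hb (by simpa using hsmall)
  rw [gen_exp_eq_genDual hz, ← mul_sub_one, norm_mul, norm_mul, norm_div, hA]
  have h1 : ‖Complex.sqrt (z / π)‖ / ‖(2 : ℂ)‖ ≤ 1 := by
    rw [RCLike.norm_ofNat]
    linarith
  calc _ ≤ 1 * rexp (π ^ 2 / 4 * (z⁻¹).re) * (C * rexp (-(2 * π ^ 2 * (z⁻¹).re))) := by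
        rw [← hQ]
        gcongr
    _ = C * rexp (π ^ 2 / 4 * (z⁻¹).re + -(2 * π ^ 2 * (z⁻¹).re)) := by
        rw [Real.exp_add]
        ring
    _ ≤ C * 1 := by
        gcongr
        rw [Real.exp_le_one_iff]
        nlinarith [mul_pos hinv (pow_pos pi_pos 2)]
    _ = C := mul_one C

theorem continuous_gen_exp {y : ℝ} (hy : 0 < y) :
    Continuous fun x : ℝ ↦ gen (Complex.exp (-(y + x * Complex.I))) := by
  refine differentiableOn_gen.continuousOn.comp_continuous (by fun_prop) fun x ↦ ?_
  simpa using norm_exp_neg_lt_one (z := y + x * Complex.I) (by simpa using hy)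

theorem add_mul_I_ne_zero {y : ℝ} (hy : 0 < y) (x : ℝ) : (y + x * Complex.I : ℂ) ≠ 0 := fun h ↦ by
  have := congr_arg Complex.re h
  simp at this
  linarith

theorem continuous_main {y : ℝ} (hy : 0 < y) : Continuous fun x : ℝ ↦
    Complex.sqrt ((y + x * Complex.I) / π) / 2 * Complex.exp (π ^ 2 / 4 / (y + x * Complex.I)) := by
  have h1 : Continuous fun x : ℝ ↦ Complex.sqrt ((y + x * Complex.I) / π) := by
    refine Continuous.cpow (by fun_prop) continuous_const fun x ↦ ?_
    rw [Complex.mem_slitPlane_iff]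
    left
    rw [Complex.div_ofReal_re]
    simpa using div_pos hy pi_pos
  have h2 : Continuous fun x : ℝ ↦ (π ^ 2 / 4 / (y + x * Complex.I) : ℂ) :=
    continuous_const.div (by fun_prop) (add_mul_I_ne_zero hy)
  fun_prop

theorem norm_exp_mul_add_mul_I (n : ℕ) (x y : ℝ) :
    ‖Complex.exp (n * (y + x * Complex.I))‖ = rexp (n * y) := by
  rw [Complex.norm_exp]
  congr 1
  rw [← Complex.ofReal_natCast, Complex.re_ofReal_mul]
  simp

theorem exists_norm_gen_le_exp : ∃ C T : ℝ, 0 < C ∧ 0 < T ∧ ∀ y : ℝ, 0 < y → y < 1 → T ≤ y⁻¹ →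
    ‖gen (Complex.exp (-(y : ℂ)))‖ ≤ C * rexp (π ^ 2 / 4 / y) := by
  obtain ⟨C, T, hC, hT, h⟩ := exists_norm_gen_sub_le
  refine ⟨C + 1, T, by positivity, hT, fun y hy0 hy1 hyT ↦ ?_⟩
  have hy1' : ‖(y : ℂ)‖ ≤ 1 := by simpa [abs_of_pos hy0] using hy1.le
  have h1 := h y (by simpa using hy0) hy1' (by rwa [← Complex.ofReal_inv, Complex.ofReal_re])
  have hS := norm_sqrt_div_pi_le_one hy1'
  have hE : ‖Complex.exp (π ^ 2 / 4 / y)‖ = rexp (π ^ 2 / 4 / y) := by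
    rw [show (π ^ 2 / 4 / y : ℂ) = ((π ^ 2 / 4 / y : ℝ) : ℂ) by push_cast; ring,
      Complex.norm_exp, Complex.ofReal_re]
  have h2 : ‖Complex.sqrt (y / π) / 2 * Complex.exp (π ^ 2 / 4 / y)‖ ≤ rexp (π ^ 2 / 4 / y) := by
    rw [norm_mul, norm_div, hE, RCLike.norm_ofNat]
    exact mul_le_of_le_one_left (exp_pos _).le (by linarith)
  have h3 : 1 ≤ rexp (π ^ 2 / 4 / y) := Real.one_le_exp (by positivity)
  have h4 := norm_le_norm_add_norm_sub' (gen (Complex.exp (-(y : ℂ))))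
    (Complex.sqrt (y / π) / 2 * Complex.exp (π ^ 2 / 4 / y))
  nlinarith

theorem norm_gen_mul_exp_le {C ν s ρ x : ℝ} (hs : 0 < s) (hρ : ρ = π / (2 * s)) (hν : ν = s * s)
    (hρ1 : ρ < 1 / 2) (hx : |x| ≤ π) (hxρ : 4 / 5 * ρ ≤ |x|)
    (hC : ‖gen (Complex.exp (-((3 / 5 * ρ : ℝ) : ℂ)))‖ ≤ C * rexp (π ^ 2 / 4 / (3 / 5 * ρ))) :
    ‖gen (Complex.exp (-((3 / 5 * ρ : ℝ) + x * Complex.I)))‖ * rexp (ν * (3 / 5 * ρ)) ≤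
      C * rexp 2 * rexp (3.1 * s) := by
  have hπ3 := Real.pi_gt_three
  have hπ4 := Real.pi_lt_d4
  have hρ0 : 0 < ρ := by rw [hρ]; positivity
  have hC0 : 0 ≤ C := nonneg_of_mul_nonneg_left ((norm_nonneg _).trans hC) (exp_pos _)
  have h1 := norm_gen_exp_le (y := 3 / 5 * ρ) (by positivity) (by linarith) hx (by linarith)
  have hexp : π ^ 2 / 4 / (3 / 5 * ρ) + (2 - 2 * (31 / 131) / (3 / 5 * ρ)) + ν * (3 / 5 * ρ) ≤
      2 + 3.1 * s := by
    have e1 : π ^ 2 / 4 / (3 / 5 * ρ) = 5 / 6 * π * s := by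
      rw [hρ]
      field_simp
      norm_num
    have e2 : 2 * (31 / 131) / (3 / 5 * ρ) = 620 / 393 / π * s := by
      rw [hρ]
      field_simp
      norm_num
    have e4 : ν * (3 / 5 * ρ) = 3 / 10 * π * s := by
      rw [hν, hρ]
      field_simp
      norm_num
    rw [e1, e2, e4]
    have e3 : 0.5 ≤ 620 / 393 / π := by
      rw [le_div_iff₀ pi_pos]
      linarith
    nlinarith
  calc _ ≤ C * rexp (π ^ 2 / 4 / (3 / 5 * ρ)) * rexp (2 - 2 * (31 / 131) / (3 / 5 * ρ)) *
        rexp (ν * (3 / 5 * ρ)) := by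
        gcongr
        exact h1.trans (by gcongr)
    _ = C * rexp (π ^ 2 / 4 / (3 / 5 * ρ) + (2 - 2 * (31 / 131) / (3 / 5 * ρ)) +
        ν * (3 / 5 * ρ)) := by
        rw [Real.exp_add, Real.exp_add]
        ring
    _ ≤ C * rexp (2 + 3.1 * s) := by gcongr
    _ = _ := by
        rw [Real.exp_add]
        ring

theorem exists_pbar_sub_integral_le : ∃ C : ℝ, ∀ᶠ n : ℕ in atTop, ∀ ρ : ℝ, ρ = π / (2 * √n) →
    ‖(pbar n : ℂ) - (2 * π)⁻¹ * ∫ x in (-(4 / 5 * ρ))..(4 / 5 * ρ),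
      Complex.sqrt (((3 / 5 * ρ : ℝ) + x * Complex.I) / π) / 2 *
        Complex.exp (π ^ 2 / 4 / ((3 / 5 * ρ : ℝ) + x * Complex.I)) *
        Complex.exp (n * ((3 / 5 * ρ : ℝ) + x * Complex.I))‖ ≤ C * rexp (3.1 * √n) := by
  obtain ⟨C, T, hC, hT, h⟩ := exists_norm_gen_sub_le
  obtain ⟨D, S, hD, hS, hgen⟩ := exists_norm_gen_le_exp
  refine ⟨D * rexp 2 + C, ?_⟩
  have hev : ∀ᶠ n : ℕ in atTop, max 4 (4 * max T S) ≤ √n :=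
    (tendsto_sqrt_atTop.comp tendsto_natCast_atTop_atTop).eventually_ge_atTop _
  filter_upwards [hev] with n hn ρ hρ
  have hπ3 := Real.pi_gt_three
  have hπ4 := Real.pi_lt_d4
  have hs4 : 4 ≤ √n := (le_max_left _ _).trans hn
  have hsT : 4 * max T S ≤ √n := (le_max_right _ _).trans hn
  have hs0 : 0 < √n := by linarith
  have hnn : (n : ℝ) = √n * √n := (Real.mul_self_sqrt (Nat.cast_nonneg n)).symm
  have hρ0 : 0 < ρ := by rw [hρ]; positivity
  have hρs : ρ * √n = π / 2 := by rw [hρ]; field_simp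
  have hρ1 : ρ < 1 / 2 := by nlinarith
  have hρTS : max T S ≤ 3 / 5 / ρ := by
    rw [hρ, div_div_eq_mul_div, le_div_iff₀ pi_pos]
    nlinarith [hT.trans_le (le_max_left T S)]
  have hρT := (le_max_left T S).trans hρTS
  have hρS := (le_max_right T S).trans hρTS
  set y := 3 / 5 * ρ with hy
  set X := 4 / 5 * ρ with hX
  have hy0 : 0 < y := by positivity
  have hny : n * y = 3 / 10 * π * √n := by
    rw [hy]
    linear_combination 3 / 5 * √n * hρs + 3 / 5 * ρ * hnn
  set g : ℝ → ℂ := fun x ↦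
    gen (Complex.exp (-(y + x * Complex.I))) * Complex.exp (n * (y + x * Complex.I)) with hg
  set f : ℝ → ℂ := fun x ↦ Complex.sqrt ((y + x * Complex.I) / π) / 2 *
    Complex.exp (π ^ 2 / 4 / (y + x * Complex.I)) * Complex.exp (n * (y + x * Complex.I)) with hf
  have hgc : Continuous g := (continuous_gen_exp hy0).mul (by fun_prop)
  have hfc : Continuous f := (continuous_main hy0).mul (by fun_prop)
  have hgi (a b : ℝ) : IntervalIntegrable g MeasureTheory.volume a b := hgc.intervalIntegrable a b
  have hXπ : X ≤ π := by linarith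
  have hmid : ‖∫ x in (-X)..X, (g x - f x)‖ ≤ C * rexp (3.1 * √n) * |X - -X| := by
    refine intervalIntegral.norm_integral_le_of_norm_le_const fun x hx ↦ ?_
    rw [Set.uIoc_of_le (by linarith)] at hx
    simp only [hg, hf, ← sub_mul, norm_mul, norm_exp_mul_add_mul_I]
    have hx2 : x ^ 2 ≤ X ^ 2 := sq_le_sq' hx.1.le hx.2
    have hnsq : Complex.normSq (y + x * Complex.I) = y ^ 2 + x ^ 2 := by
      simp [Complex.normSq_apply]
      ring
    have hzsq : y ^ 2 + x ^ 2 ≤ ρ ^ 2 := by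
      have : y ^ 2 + X ^ 2 = ρ ^ 2 := by rw [hy, hX]; ring
      linarith
    refine mul_le_mul (h _ (by simpa using hy0) ?_ ?_) (Real.exp_le_exp.mpr ?_) (exp_pos _).le hC.le
    · have h1 : ‖(y + x * Complex.I : ℂ)‖ ^ 2 ≤ ρ ^ 2 := by
        rwa [← Complex.normSq_eq_norm_sq, hnsq]
      linarith [abs_le_of_sq_le_sq' h1 hρ0.le]
    · rw [Complex.inv_re, hnsq]
      refine hρT.trans ?_
      have : (y + x * Complex.I : ℂ).re = y := by simp
      rw [this, div_le_div_iff₀ hρ0 (by positivity), hy]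
      nlinarith
    · rw [hny]
      nlinarith
  have hy1 : y < 1 := by linarith
  have hbd (x : ℝ) (hx : |x| ≤ π) (hxX : X ≤ |x|) : ‖g x‖ ≤ D * rexp 2 * rexp (3.1 * √n) := by
    simp only [hg, norm_mul, norm_exp_mul_add_mul_I]
    refine norm_gen_mul_exp_le hs0 hρ hnn hρ1 hx (by linarith) ((hgen y hy0 hy1 ?_))
    rw [hy, inv_eq_one_div, le_div_iff₀ (by positivity)]
    rw [le_div_iff₀ hρ0] at hρS
    linarith
  have hleft : ‖∫ x in (-π)..(-X), g x‖ ≤ D * rexp 2 * rexp (3.1 * √n) * |-X - -π| := by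
    refine intervalIntegral.norm_integral_le_of_norm_le_const fun x hx ↦ hbd x ?_ ?_
    all_goals rw [Set.uIoc_of_le (by linarith)] at hx
    · exact abs_le.mpr ⟨hx.1.le, by linarith [hx.2]⟩
    · exact le_abs.mpr (Or.inr (by linarith [hx.2]))
  have hright : ‖∫ x in X..π, g x‖ ≤ D * rexp 2 * rexp (3.1 * √n) * |π - X| := by
    refine intervalIntegral.norm_integral_le_of_norm_le_const fun x hx ↦ hbd x ?_ ?_
    all_goals rw [Set.uIoc_of_le (by linarith)] at hx
    · exact abs_le.mpr ⟨by linarith [hx.1], hx.2⟩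
    · exact le_abs.mpr (Or.inl hx.1.le)
  have hsplit : (pbar n : ℂ) - (2 * π)⁻¹ * ∫ x in (-X)..X, f x = (2 * π)⁻¹ *
      ((∫ x in (-π)..(-X), g x) + (∫ x in (-X)..X, (g x - f x)) + ∫ x in X..π, g x) := by
    rw [intervalIntegral.integral_sub (hgi _ _) (hfc.intervalIntegrable _ _),
      pbar_eq_integral n hy0, ← intervalIntegral.integral_add_adjacent_intervals (hgi (-π) X) (hgi X π),
      ← intervalIntegral.integral_add_adjacent_intervals (hgi (-π) (-X)) (hgi (-X) X)]
    ring
  have hX0 : 0 < X := by positivity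
  rw [abs_of_nonneg (by linarith)] at hmid hleft hright
  rw [hsplit, norm_mul]
  have hn2 : ‖(((2 * π)⁻¹ : ℝ) : ℂ)‖ = (2 * π)⁻¹ := by
    rw [Complex.norm_real, Real.norm_of_nonneg (by positivity)]
  rw [hn2, inv_mul_le_iff₀ (by positivity)]
  refine (norm_add₃_le ..).trans ((add_le_add_three hleft hmid hright).trans ?_)
  have hP : 0 < rexp 2 := exp_pos _
  have hQ : 0 < rexp (3.1 * √n) := exp_pos _
  have h1 : D * rexp 2 * rexp (3.1 * √n) * (-X - -π) ≤
      D * rexp 2 * rexp (3.1 * √n) * π := by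
    gcongr
    linarith
  have h2 : D * rexp 2 * rexp (3.1 * √n) * (π - X) ≤
      D * rexp 2 * rexp (3.1 * √n) * π := by
    gcongr
    linarith
  have h3 : C * rexp (3.1 * √n) * (X - -X) ≤ C * rexp (3.1 * √n) * (2 * π) := by
    gcongr
    linarith
  linear_combination h1 + h2 + h3

theorem csqrt_ofReal_mul {r : ℝ} (hr : 0 < r) {w : ℂ} (hw : w ≠ 0) :
    Complex.sqrt (r * w) = √r * Complex.sqrt w := by
  have hr' : (r : ℂ) ≠ 0 := by exact_mod_cast hr.ne'
  rw [Complex.sqrt, Complex.cpow_def_of_ne_zero (mul_ne_zero hr' hw),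
    Complex.log_ofReal_mul hr hw, add_mul, Complex.exp_add, Complex.sqrt,
    Complex.cpow_def_of_ne_zero hw]
  congr 1
  rw [Real.sqrt_eq_rpow, Real.rpow_def_of_pos hr, Complex.ofReal_exp]
  push_cast
  norm_num

theorem csqrt_exp_mul_I {θ : ℝ} (h1 : -π < θ) (h2 : θ < π) :
    Complex.sqrt (Complex.exp (θ * Complex.I)) = Complex.exp (θ / 2 * Complex.I) := by
  rw [Complex.sqrt, Complex.cpow_def_of_ne_zero (Complex.exp_ne_zero _),
    Complex.log_exp (by simpa using h1) (by simpa using h2.le)]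
  congr 1
  ring

theorem add_mul_I_mem_ball {a b : ℝ} (h : a ^ 2 + b ^ 2 < 2 * a) :
    (a + b * Complex.I : ℂ) ∈ Metric.ball 1 1 := by
  rw [Metric.mem_ball, dist_eq_norm, ← sq_lt_one_iff₀ (norm_nonneg _),
    ← Complex.normSq_eq_norm_sq, Complex.normSq_apply]
  simp
  linarith

theorem exp_mul_I_mem_ball {θ : ℝ} (hθ : θ ∈ Set.uIcc (-arccos (3 / 5)) (arccos (3 / 5))) :
    Complex.exp (θ * Complex.I) ∈ Metric.ball 1 1 := by
  have hcos : cos (arccos (3 / 5)) = 3 / 5 := cos_arccos (by norm_num) (by norm_num)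
  rw [Set.uIcc_of_le (by linarith [arccos_nonneg (3 / 5)])] at hθ
  have h1 : cos (arccos (3 / 5)) ≤ cos θ := by
    rw [← cos_abs θ]
    exact cos_le_cos_of_nonneg_of_le_pi (abs_nonneg _) (arccos_le_pi _) (abs_le.mpr hθ)
  rw [Complex.exp_mul_I, ← Complex.ofReal_cos, ← Complex.ofReal_sin]
  refine add_mul_I_mem_ball ?_
  linarith [sin_sq_add_cos_sq θ]

theorem chord_integral_eq_arc_integral {G : ℂ → ℂ} (hG : DifferentiableOn ℂ G (Metric.ball 1 1)) :
    ∫ t in (-(4 / 5 : ℝ))..(4 / 5), G ((3 / 5 : ℝ) + t * Complex.I) =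
      ∫ θ in (-arccos (3 / 5))..(arccos (3 / 5)),
        G (Complex.exp (θ * Complex.I)) * Complex.exp (θ * Complex.I) := by
  obtain ⟨F, hF⟩ := hG.isExactOn_ball
  set α := arccos (3 / 5) with hα
  have hcos : cos α = 3 / 5 := cos_arccos (by norm_num) (by norm_num)
  have hsin : sin α = 4 / 5 := by
    rw [hα, sin_arccos, show (1 - (3 / 5 : ℝ) ^ 2) = (4 / 5) ^ 2 by norm_num,
      Real.sqrt_sq (by norm_num)]
  have hα0 : 0 ≤ α := arccos_nonneg _
  have memL {t : ℝ} (ht : t ∈ Set.uIcc (-(4 / 5 : ℝ)) (4 / 5)) :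
      ((3 / 5 : ℝ) + t * Complex.I : ℂ) ∈ Metric.ball 1 1 := by
    rw [Set.uIcc_of_le (by norm_num)] at ht
    have := sq_le_sq' ht.1 ht.2
    exact add_mul_I_mem_ball (by linarith)
  have hL (t : ℝ) (ht : t ∈ Set.uIcc (-(4 / 5 : ℝ)) (4 / 5)) :
      HasDerivAt (fun t : ℝ ↦ F ((3 / 5 : ℝ) + t * Complex.I))
        (G ((3 / 5 : ℝ) + t * Complex.I) * Complex.I) t := by
    have h1 : HasDerivAt (fun t : ℝ ↦ ((3 / 5 : ℝ) + t * Complex.I : ℂ)) Complex.I t := by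
      simpa using ((Complex.ofRealCLM.hasDerivAt (x := t)).mul_const Complex.I).const_add
        ((3 / 5 : ℝ) : ℂ)
    exact (hF _ (memL ht)).comp t h1
  have hA (θ : ℝ) (hθ : θ ∈ Set.uIcc (-α) α) :
      HasDerivAt (fun θ : ℝ ↦ F (Complex.exp (θ * Complex.I)))
        (G (Complex.exp (θ * Complex.I)) * (Complex.exp (θ * Complex.I) * Complex.I)) θ := by
    have h1 : HasDerivAt (fun θ : ℝ ↦ Complex.exp (θ * Complex.I))
        (Complex.exp (θ * Complex.I) * Complex.I) θ := by
      simpa using ((Complex.ofRealCLM.hasDerivAt (x := θ)).mul_const Complex.I).cexp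
    exact (hF _ (exp_mul_I_mem_ball hθ)).comp θ h1
  have hLi := intervalIntegral.integral_eq_sub_of_hasDerivAt hL
    ((ContinuousOn.mul (hG.continuousOn.comp (by fun_prop) fun t ht ↦ memL ht)
      continuousOn_const).intervalIntegrable)
  have hAi := intervalIntegral.integral_eq_sub_of_hasDerivAt hA
    ((ContinuousOn.mul (hG.continuousOn.comp (by fun_prop) fun t ht ↦ exp_mul_I_mem_ball ht)
      (by fun_prop)).intervalIntegrable)
  have e1 : Complex.exp (α * Complex.I) = (3 / 5 : ℝ) + (4 / 5 : ℝ) * Complex.I := by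
    rw [Complex.exp_mul_I, ← Complex.ofReal_cos, ← Complex.ofReal_sin, hcos, hsin]
  have e2 : Complex.exp ((-α : ℝ) * Complex.I) = (3 / 5 : ℝ) + (-(4 / 5) : ℝ) * Complex.I := by
    rw [Complex.exp_mul_I, ← Complex.ofReal_cos, ← Complex.ofReal_sin, cos_neg, sin_neg, hcos, hsin]
  rw [e1, e2, ← hLi] at hAi
  simp only [← mul_assoc, intervalIntegral.integral_mul_const] at hAi
  exact (mul_right_cancel₀ Complex.I_ne_zero hAi).symm

theorem chord_integral_re (m : ℝ) :
    (∫ t in (-(4 / 5 : ℝ))..(4 / 5), Complex.sqrt ((3 / 5 : ℝ) + t * Complex.I) *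
      Complex.exp (m / 2 * (((3 / 5 : ℝ) + t * Complex.I) + ((3 / 5 : ℝ) + t * Complex.I)⁻¹))).re =
    ∫ θ in (-arccos (3 / 5))..(arccos (3 / 5)), cos (3 * (θ / 2)) * rexp (m * cos θ) := by
  have hG : DifferentiableOn ℂ (fun w : ℂ ↦ Complex.sqrt w * Complex.exp (m / 2 * (w + w⁻¹)))
      (Metric.ball 1 1) := by
    intro w hw
    have hre : 0 < w.re := by
      rw [Metric.mem_ball, dist_comm, dist_eq_norm] at hw
      have := (Complex.re_le_norm (1 - w)).trans_lt hw
      simp at this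
      exact this
    have hs : w ∈ Complex.slitPlane := Or.inl hre
    have hw0 := Complex.slitPlane_ne_zero hs
    refine DifferentiableAt.differentiableWithinAt ?_
    have h1 : DifferentiableAt ℂ Complex.sqrt w := Complex.differentiableAt_sqrt hs
    fun_prop (disch := assumption)
  rw [chord_integral_eq_arc_integral hG, ← Complex.reCLM_apply,
    ← Complex.reCLM.intervalIntegral_comp_comm]
  · refine intervalIntegral.integral_congr fun θ hθ ↦ ?_
    have hα0 : 0 ≤ arccos (3 / 5) := arccos_nonneg _
    have hα1 : arccos (3 / 5) < π := by
      have : arccos (3 / 5) < π / 2 := by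
        rw [arccos_lt_pi_div_two]
        norm_num
      linarith [pi_pos]
    rw [Set.uIcc_of_le (by linarith)] at hθ
    simp only [Complex.reCLM_apply]
    rw [csqrt_exp_mul_I (by linarith [hθ.1]) (by linarith [hθ.2]), ← Complex.exp_neg,
      ← Complex.exp_add, ← Complex.exp_add]
    have h1 : Complex.exp (θ * Complex.I) + Complex.exp (-(θ * Complex.I)) = 2 * cos θ := by
      rw [Complex.ofReal_cos, Complex.two_cos, neg_mul]
    rw [h1, Complex.exp_re]
    have h2 : (θ / 2 * Complex.I + m / 2 * (2 * (cos θ : ℂ)) + θ * Complex.I : ℂ) =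
        ((m * cos θ : ℝ) : ℂ) + ((3 * (θ / 2) : ℝ) : ℂ) * Complex.I := by
      push_cast
      ring
    rw [h2]
    simp only [Complex.add_re, Complex.add_im, Complex.re_ofReal_mul, Complex.im_ofReal_mul,
      Complex.I_re, Complex.I_im, Complex.ofReal_re, Complex.ofReal_im, mul_zero, mul_one, add_zero,
      zero_add]
    rw [mul_comm]
  · exact ContinuousOn.intervalIntegrable ((hG.continuousOn.comp (by fun_prop)
      fun θ hθ ↦ exp_mul_I_mem_ball hθ).mul (by fun_prop))

theorem arc_integral_eq_gaussian (m : ℝ) :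
    ∫ θ in (-arccos (3 / 5))..(arccos (3 / 5)), cos (3 * (θ / 2)) * rexp (m * cos θ) =
      2 * rexp m * ∫ σ in (-√(1 / 5))..√(1 / 5), (1 - 4 * σ ^ 2) * rexp (-(2 * m) * σ ^ 2) := by
  have hα0 : 0 ≤ arccos (3 / 5) := arccos_nonneg _
  have hend : sin (arccos (3 / 5) / 2) = √(1 / 5) := by
    rw [sin_half_eq_sqrt hα0 (by linarith [arccos_le_pi (3 / 5), pi_pos]),
      cos_arccos (by norm_num) (by norm_num)]
    norm_num
  have hend' : sin (-arccos (3 / 5) / 2) = -√(1 / 5) := by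
    rw [neg_div, sin_neg, hend]
  have h := intervalIntegral.integral_comp_mul_deriv (a := -arccos (3 / 5)) (b := arccos (3 / 5))
    (f := fun θ ↦ sin (θ / 2)) (f' := fun θ ↦ cos (θ / 2) * (1 / 2))
    (g := fun σ ↦ 2 * rexp m * ((1 - 4 * σ ^ 2) * rexp (-(2 * m) * σ ^ 2)))
    (fun θ _ ↦ by simpa using ((hasDerivAt_id θ).div_const 2).sin) (by fun_prop) (by fun_prop)
  simp only [hend, hend', intervalIntegral.integral_const_mul] at h
  rw [← h]
  refine intervalIntegral.integral_congr fun θ _ ↦ ?_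
  simp only [Function.comp_apply]
  have h1 : m * cos θ = m + -(2 * m) * sin (θ / 2) ^ 2 := by
    rw [show cos θ = cos (2 * (θ / 2)) by ring_nf, cos_two_mul, cos_sq']
    ring
  rw [h1, Real.exp_add, cos_three_mul]
  linear_combination (4 * cos (θ / 2)) * rexp m * rexp (-(2 * m) * sin (θ / 2) ^ 2) *
    sin_sq_add_cos_sq (θ / 2)

theorem abs_integral_gaussian_sub_le {M s : ℝ} (hM : 0 < M) (hs : 0 ≤ s) :
    |(∫ σ in (-s)..s, rexp (-M * σ ^ 2)) - √(π / M)| ≤ rexp (-(M / 2 * s ^ 2)) * √(2 * π / M) := by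
  have hi := integrable_exp_neg_mul_sq hM
  have hi2 := integrable_exp_neg_mul_sq (half_pos hM)
  have h1 := MeasureTheory.integral_add_compl (measurableSet_Ioc (a := -s) (b := s)) hi
  have h2 : ∫ σ in (Set.Ioc (-s) s)ᶜ, rexp (-M * σ ^ 2) ≤
      ∫ σ in (Set.Ioc (-s) s)ᶜ, rexp (-(M / 2 * s ^ 2)) * rexp (-(M / 2) * σ ^ 2) := by
    refine MeasureTheory.setIntegral_mono_on hi.integrableOn (hi2.const_mul _).integrableOn
      measurableSet_Ioc.compl fun σ hσ ↦ ?_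
    rw [← Real.exp_add]
    apply Real.exp_le_exp.mpr
    have h3 : s ^ 2 ≤ σ ^ 2 := by
      rw [sq_le_sq, abs_of_nonneg hs]
      rw [Set.mem_compl_iff, Set.mem_Ioc, not_and_or, not_lt, not_le] at hσ
      exact le_abs'.mpr (hσ.imp id le_of_lt)
    nlinarith
  have h3 : ∫ σ in (Set.Ioc (-s) s)ᶜ, rexp (-(M / 2 * s ^ 2)) * rexp (-(M / 2) * σ ^ 2) ≤
      rexp (-(M / 2 * s ^ 2)) * √(2 * π / M) := by
    refine (MeasureTheory.setIntegral_le_integral (hi2.const_mul _)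
      (.of_forall fun _ ↦ by positivity)).trans_eq ?_
    rw [MeasureTheory.integral_const_mul, integral_gaussian]
    congr 2
    field_simp
  have h4 : 0 ≤ ∫ σ in (Set.Ioc (-s) s)ᶜ, rexp (-M * σ ^ 2) :=
    MeasureTheory.integral_nonneg fun _ ↦ (exp_pos _).le
  rw [intervalIntegral.integral_of_le (by linarith), abs_le]
  rw [integral_gaussian] at h1
  constructor <;> linarith

theorem abs_integral_quadratic_gaussian_sub_le {M : ℝ} (hM : 2 ≤ M) :
    |(∫ σ in (-√(1 / 5))..√(1 / 5), (1 - 4 * σ ^ 2) * rexp (-M * σ ^ 2)) -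
      (1 - 2 / M) * √(π / M)| ≤ 4 * rexp (-(M / 10)) := by
  have hM0 : 0 < M := by linarith
  set s := √(1 / 5 : ℝ) with hs
  have hs2 : s ^ 2 = 1 / 5 := Real.sq_sqrt (by norm_num)
  have hs0 : 0 ≤ s := Real.sqrt_nonneg _
  have hs1 : s ≤ 1 / 2 := by nlinarith
  have hderiv (σ : ℝ) : HasDerivAt (fun σ ↦ 2 / M * (σ * rexp (-M * σ ^ 2)))
      ((1 - 4 * σ ^ 2) * rexp (-M * σ ^ 2) - (1 - 2 / M) * rexp (-M * σ ^ 2)) σ := by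
    have h1 : HasDerivAt (fun σ ↦ -M * σ ^ 2) (-M * (2 * σ)) σ := by
      simpa using (hasDerivAt_pow 2 σ).const_mul (-M)
    convert! ((hasDerivAt_id σ).mul h1.exp).const_mul (2 / M) using 1
    simp only [id]
    field_simp
    ring
  have h1 := intervalIntegral.integral_eq_sub_of_hasDerivAt (a := -s) (b := s)
    (fun σ _ ↦ hderiv σ) (Continuous.intervalIntegrable (by fun_prop) _ _)
  rw [intervalIntegral.integral_sub (Continuous.intervalIntegrable (by fun_prop) _ _)
    (Continuous.intervalIntegrable (by fun_prop) _ _), intervalIntegral.integral_const_mul,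
    neg_sq, hs2] at h1
  have h2 := abs_integral_gaussian_sub_le hM0 hs0
  rw [hs2, show M / 2 * (1 / 5) = M / 10 by ring] at h2
  have hE : rexp (-M * (1 / 5)) ≤ rexp (-(M / 10)) := Real.exp_le_exp.mpr (by linarith)
  have h3 : √(2 * π / M) ≤ 2 := by
    rw [Real.sqrt_le_left (by norm_num), div_le_iff₀ hM0]
    nlinarith [Real.pi_lt_d4]
  have h4 : 2 / M ≤ 1 := (div_le_one hM0).mpr hM
  have h5 : 0 ≤ 2 / M := by positivity
  have hpos := exp_pos (-M * (1 / 5))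
  have h6 : |2 / M * (s * rexp (-M * (1 / 5))) - 2 / M * (-s * rexp (-M * (1 / 5)))| ≤
      rexp (-(M / 10)) := by
    rw [abs_of_nonneg (by nlinarith [mul_nonneg h5 (mul_nonneg hs0 hpos.le)])]
    have : 2 / M * (s * rexp (-M * (1 / 5))) ≤ 1 * (1 / 2 * rexp (-M * (1 / 5))) := by gcongr
    linarith
  have h7 : |(1 - 2 / M) * ((∫ σ in (-s)..s, rexp (-M * σ ^ 2)) - √(π / M))| ≤
      1 * (rexp (-(M / 10)) * 2) := by
    rw [abs_mul, abs_of_nonneg (by linarith)]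
    refine mul_le_mul (by linarith) (h2.trans (by gcongr)) (abs_nonneg _) zero_le_one
  have h8 : (∫ σ in (-s)..s, (1 - 4 * σ ^ 2) * rexp (-M * σ ^ 2)) - (1 - 2 / M) * √(π / M) =
      (2 / M * (s * rexp (-M * (1 / 5))) - 2 / M * (-s * rexp (-M * (1 / 5)))) +
      (1 - 2 / M) * ((∫ σ in (-s)..s, rexp (-M * σ ^ 2)) - √(π / M)) := by
    linear_combination h1
  rw [h8]
  refine (abs_add_le _ _).trans ?_
  linarith [exp_pos (-(M / 10))]

theorem main_integral_eq {n ρ : ℝ} (hn : 0 < n) (hρ : ρ = π / (2 * √n)) :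
    ∫ x in (-(4 / 5 * ρ))..(4 / 5 * ρ),
      Complex.sqrt (((3 / 5 * ρ : ℝ) + x * Complex.I) / π) / 2 *
        Complex.exp (π ^ 2 / 4 / ((3 / 5 * ρ : ℝ) + x * Complex.I)) *
        Complex.exp (n * ((3 / 5 * ρ : ℝ) + x * Complex.I)) =
    (ρ * √(ρ / π) / 2 : ℝ) * ∫ t in (-(4 / 5 : ℝ))..(4 / 5),
      Complex.sqrt ((3 / 5 : ℝ) + t * Complex.I) * Complex.exp ((π * √n : ℝ) / 2 *
        (((3 / 5 : ℝ) + t * Complex.I) + ((3 / 5 : ℝ) + t * Complex.I)⁻¹)) := by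
  have hs : 0 < √n := Real.sqrt_pos.mpr hn
  have hρ0 : 0 < ρ := by rw [hρ]; positivity
  have hρ' : (ρ : ℂ) ≠ 0 := by exact_mod_cast hρ0.ne'
  rw [show -(4 / 5 * ρ) = ρ * -(4 / 5) by ring, mul_comm (4 / 5) ρ,
    ← intervalIntegral.smul_integral_comp_mul_left, Complex.real_smul,
    ← intervalIntegral.integral_const_mul, ← intervalIntegral.integral_const_mul]
  refine intervalIntegral.integral_congr fun t _ ↦ ?_
  have hw := add_mul_I_ne_zero (show (0 : ℝ) < 3 / 5 by norm_num) t
  set w : ℂ := (3 / 5 : ℝ) + t * Complex.I with hwdef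
  have e1 : ((3 / 5 * ρ : ℝ) + (ρ * t : ℝ) * Complex.I : ℂ) = ρ * w := by
    rw [hwdef]
    push_cast
    ring
  have hs1 : (ρ : ℂ) * √n = π / 2 := by
    have : ρ * √n = π / 2 := by rw [hρ]; field_simp
    exact_mod_cast this
  have hnn : (n : ℂ) = √n * √n := by exact_mod_cast (Real.mul_self_sqrt hn.le).symm
  have e2 : (π ^ 2 / 4 / (ρ * w) : ℂ) + n * (ρ * w) = (π * √n : ℝ) / 2 * (w + w⁻¹) := by
    rw [hnn]
    push_cast
    have : (π : ℂ) = 2 * (ρ * √n) := by rw [hs1]; ring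
    rw [this]
    field_simp
    ring
  simp only [e1]
  rw [mul_div_right_comm, ← Complex.ofReal_div, csqrt_ofReal_mul (by positivity) hw,
    mul_assoc _ (Complex.exp _), ← Complex.exp_add, e2]
  push_cast
  ring

theorem exists_abs_pbar_sub_le : ∃ C : ℝ, ∀ᶠ n : ℕ in atTop,
    |(pbar n : ℝ) - rexp (π * √n) / (8 * n) * (1 - 1 / (π * √n))| ≤ C * rexp (3.1 * √n) := by
  obtain ⟨C, h⟩ := exists_pbar_sub_integral_le
  refine ⟨C + 4, ?_⟩
  filter_upwards [h, eventually_ge_atTop 1] with n hn hn1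
  have hn1' : (1 : ℝ) ≤ n := by exact_mod_cast hn1
  have hn0 : (0 : ℝ) < n := by linarith
  have hs1 : 1 ≤ √n := Real.one_le_sqrt.mpr hn1'
  have hs0 : 0 < √n := by linarith
  have hπ3 := Real.pi_gt_three
  have hπ4 := Real.pi_lt_d4
  set s := √(n : ℝ) with hs
  have hss : (n : ℝ) = s * s := (Real.mul_self_sqrt hn0.le).symm
  obtain ⟨ρ, hρ⟩ : ∃ ρ, ρ = π / (2 * s) := ⟨_, rfl⟩
  have hρ0 : 0 < ρ := by rw [hρ]; positivity
  have hρ2 : ρ ≤ 2 := by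
    rw [hρ, div_le_iff₀ (by positivity)]
    nlinarith
  have h1 := hn ρ hρ
  rw [← Complex.ofReal_natCast n, main_integral_eq hn0 hρ, ← mul_assoc, ← Complex.ofReal_mul] at h1
  have h2 := (Complex.abs_re_le_norm _).trans h1
  rw [Complex.sub_re, Complex.natCast_re, Complex.re_ofReal_mul, chord_integral_re,
    arc_integral_eq_gaussian, ← hs] at h2
  have hm : 2 ≤ 2 * (π * s) := by nlinarith
  have h3 := abs_integral_quadratic_gaussian_sub_le hm
  set K := ∫ σ in (-√(1 / 5))..√(1 / 5), (1 - 4 * σ ^ 2) * rexp (-(2 * (π * s)) * σ ^ 2) with hK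
  set c := (2 * π)⁻¹ * (ρ * √(ρ / π) / 2) * (2 * rexp (π * s)) with hc
  have hc0 : 0 ≤ c := by positivity
  have hmain : c * ((1 - 2 / (2 * (π * s))) * √(π / (2 * (π * s)))) =
      rexp (π * s) / (8 * n) * (1 - 1 / (π * s)) := by
    have e1 : √(ρ / π) * √(π / (2 * (π * s))) = ρ / π := by
      rw [← Real.sqrt_mul (by positivity), Real.sqrt_eq_iff_mul_self_eq (by positivity)
        (by positivity), hρ]
      field_simp
    have e2 : c * ((1 - 2 / (2 * (π * s))) * √(π / (2 * (π * s)))) = (2 * π)⁻¹ * ρ *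
        (√(ρ / π) * √(π / (2 * (π * s)))) * rexp (π * s) * (1 - 1 / (π * s)) := by
      rw [hc]
      field_simp
    rw [e2, e1, hρ, hss]
    field_simp
    ring
  have hcb : c ≤ rexp (π * s) := by
    have e1 : √(ρ / π) ≤ 1 := by
      rw [Real.sqrt_le_one, div_le_one pi_pos]
      linarith
    have e2 : (2 * π)⁻¹ ≤ 1 / 2 := by
      rw [inv_eq_one_div]
      gcongr
      linarith
    calc c ≤ 1 / 2 * (2 * 1 / 2) * (2 * rexp (π * s)) := by
          rw [hc]
          gcongr
      _ = rexp (π * s) := by ring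
  have herr : |c * (K - (1 - 2 / (2 * (π * s))) * √(π / (2 * (π * s))))| ≤
      4 * rexp (3.1 * s) := by
    rw [abs_mul, abs_of_nonneg hc0]
    calc _ ≤ rexp (π * s) * (4 * rexp (-(2 * (π * s) / 10))) := by gcongr
      _ = 4 * rexp (π * s + -(2 * (π * s) / 10)) := by
        rw [Real.exp_add]
        ring
      _ ≤ 4 * rexp (3.1 * s) := by
        gcongr
        nlinarith
  have hsum : (pbar n : ℝ) - rexp (π * s) / (8 * n) * (1 - 1 / (π * s)) =
      ((pbar n : ℝ) - (2 * π)⁻¹ * (ρ * √(ρ / π) / 2) * (2 * rexp (π * s) * K)) +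
      c * (K - (1 - 2 / (2 * (π * s))) * √(π / (2 * (π * s)))) := by
    rw [← hmain, hc]
    ring
  rw [hsum]
  refine (abs_add_le _ _).trans ?_
  linarith

theorem hasDerivAt_fwdDiff_iter {f f' : ℝ → ℝ} (hf : ∀ x, 0 < x → HasDerivAt f (f' x) x) (r : ℕ)
    {x : ℝ} (hx : 0 < x) : HasDerivAt ((fwdDiff 1)^[r] f) ((fwdDiff 1)^[r] f' x) x := by
  induction r generalizing x with
  | zero => exact hf x hx
  | succ r ih =>
    simp only [Function.iterate_succ_apply', fwdDiff]
    exact ((ih (by linarith)).comp_add_const x 1).sub (ih hx)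

theorem exists_fwdDiff_iter_eq {f : ℕ → ℝ → ℝ}
    (hf : ∀ k x, 0 < x → HasDerivAt (f k) (f (k + 1) x) x) (r : ℕ) {x : ℝ} (hx : 0 < x) :
    ∃ ξ ∈ Set.Icc x (x + r), (fwdDiff 1)^[r] (f 0) x = f r ξ := by
  induction r generalizing f x with
  | zero => exact ⟨x, by simp, rfl⟩
  | succ r ih =>
    have hd (y : ℝ) (hy : 0 < y) := hasDerivAt_fwdDiff_iter (hf 0) r hy
    obtain ⟨η, hη, h⟩ := exists_hasDerivAt_eq_slope _ _ (show x < x + 1 by linarith)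
      (fun y hy ↦ (hd y (hx.trans_le hy.1)).continuousAt.continuousWithinAt)
      (fun y hy ↦ hd y (hx.trans hy.1))
    obtain ⟨ξ, hξ, h'⟩ := ih (fun k ↦ hf (k + 1)) (hx.trans hη.1)
    refine ⟨ξ, ⟨hη.1.le.trans hξ.1, hξ.2.trans ?_⟩, ?_⟩
    · push_cast
      linarith [hη.2]
    · rw [← h', Function.iterate_succ_apply', fwdDiff]
      rw [add_sub_cancel_left, div_one] at h
      exact h.symm

theorem fwdDiff_iter_natCast (f : ℝ → ℝ) (r n : ℕ) :
    (fwdDiff 1)^[r] (fun m : ℕ ↦ f m) n = (fwdDiff 1)^[r] f (n : ℝ) := by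
  simp [fwdDiff_iter_eq_sum_shift]

theorem tendsto_rpow_mul_fwdDiff_iter {f : ℕ → ℝ → ℝ}
    (hf : ∀ k x, 0 < x → HasDerivAt (f k) (f (k + 1) x) x) {r : ℕ} {p L : ℝ}
    (h : Tendsto (fun x ↦ x ^ p * f r x) atTop (nhds L)) :
    Tendsto (fun n : ℕ ↦ (n : ℝ) ^ p * (fwdDiff 1)^[r] (fun m : ℕ ↦ f 0 m) n) atTop (nhds L) := by
  choose ξ hξ hfξ using fun n : ℕ ↦ exists_fwdDiff_iter_eq hf r (show (0 : ℝ) < n + 1 by positivity)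
  have hξ0 (n : ℕ) : 0 < ξ n := lt_of_lt_of_le (by positivity) (hξ n).1
  have hξt : Tendsto ξ atTop atTop := tendsto_atTop_mono (fun n ↦ (hξ n).1)
    (tendsto_atTop_add_const_right _ _ tendsto_natCast_atTop_atTop)
  have hquot : Tendsto (fun n : ℕ ↦ ((n : ℝ) + 1) / ξ n) atTop (nhds 1) := by
    have hl : Tendsto (fun n : ℕ ↦ 1 - r / ((n : ℝ) + 1)) atTop (nhds 1) := by
      simpa using tendsto_const_nhds.sub ((tendsto_atTop_add_const_right _ (1 : ℝ)
        tendsto_natCast_atTop_atTop).const_div_atTop (r : ℝ))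
    refine tendsto_of_tendsto_of_tendsto_of_le_of_le hl tendsto_const_nhds (fun n ↦ ?_)
      (fun n ↦ (div_le_one (hξ0 n)).mpr (hξ n).1)
    have hn : (0 : ℝ) < n + 1 := by positivity
    rw [le_div_iff₀ (hξ0 n), sub_mul, one_mul, sub_le_iff_le_add]
    have h1 : r ≤ r / ((n : ℝ) + 1) * ξ n := by
      rw [div_mul_eq_mul_div, le_div_iff₀ hn]
      exact mul_le_mul_of_nonneg_left (hξ n).1 (by positivity)
    linarith [(hξ n).2]
  rw [← tendsto_add_atTop_iff_nat 1]
  have h1 := (hquot.rpow_const (p := p) (.inl one_ne_zero)).mul (h.comp hξt)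
  rw [one_rpow, one_mul] at h1
  refine h1.congr fun n ↦ ?_
  rw [fwdDiff_iter_natCast, Nat.cast_add_one, hfξ, Function.comp_apply,
    div_rpow (by positivity) (hξ0 n).le]
  have := (rpow_pos_of_pos (hξ0 n) p).ne'
  field_simp

theorem tendsto_rpow_mul_fwdDiff_iter_zero {f : ℕ → ℝ} {p : ℝ} (hp : 0 ≤ p)
    (h : Tendsto (fun n : ℕ ↦ (n : ℝ) ^ p * f n) atTop (nhds 0)) (r : ℕ) :
    Tendsto (fun n : ℕ ↦ (n : ℝ) ^ p * (fwdDiff 1)^[r] f n) atTop (nhds 0) := by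
  induction r with
  | zero => exact h
  | succ r ih =>
    simp only [Function.iterate_succ_apply', fwdDiff, mul_sub]
    rw [← sub_zero (0 : ℝ)]
    refine .sub (squeeze_zero_norm (fun n ↦ ?_)
      (tendsto_norm_zero.comp ((tendsto_add_atTop_iff_nat 1).mpr ih))) ih
    simp only [Function.comp_apply, norm_mul, Nat.cast_add_one]
    refine mul_le_mul_of_nonneg_right ?_ (norm_nonneg _)
    rw [norm_of_nonneg (by positivity), norm_of_nonneg (by positivity)]
    exact rpow_le_rpow (by positivity) (by linarith) hp

theorem hasDerivAt_ascPochhammer_mul_rpow (s : ℝ) (k : ℕ) {x : ℝ} (hx : 0 < x) :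
    HasDerivAt (fun x ↦ (-1) ^ k * (ascPochhammer ℝ k).eval s * x ^ (-(s + k)))
      ((-1) ^ (k + 1) * (ascPochhammer ℝ (k + 1)).eval s * x ^ (-(s + (k + 1 : ℕ)))) x := by
  have h := (hasDerivAt_rpow_const (p := -(s + k)) (.inl hx.ne')).const_mul
    ((-1) ^ k * (ascPochhammer ℝ k).eval s)
  convert! h using 1
  rw [ascPochhammer_succ_eval, show -(s + k) - 1 = -(s + (k + 1 : ℕ)) by push_cast; ring]
  ring

theorem hasDerivAt_log_sub_harmonic_mul_rpow (k : ℕ) {x : ℝ} (hx : 0 < x) :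
    HasDerivAt (fun x ↦ (-1) ^ k * k.factorial * ((log x - harmonic k) * x ^ (-(1 + k : ℝ))))
      ((-1) ^ (k + 1) * (k + 1).factorial *
        ((log x - harmonic (k + 1)) * x ^ (-(1 + (k + 1 : ℕ) : ℝ)))) x := by
  have h := (((hasDerivAt_log hx.ne').sub_const (harmonic k : ℝ)).mul
    (hasDerivAt_rpow_const (p := -(1 + k : ℝ)) (.inl hx.ne'))).const_mul
    ((-1) ^ k * (k.factorial : ℝ))
  convert! h using 1
  rw [harmonic_succ, show -(1 + k : ℝ) - 1 = -(1 + (k + 1 : ℕ)) by push_cast; ring,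
    show x ^ (-(1 + k : ℝ)) = x * x ^ (-(1 + (k + 1 : ℕ) : ℝ)) by
      rw [← rpow_one_add' hx.le (by push_cast; linarith [k.cast_nonneg (α := ℝ)])]
      push_cast
      ring_nf, Nat.factorial_succ]
  push_cast
  field_simp
  ring

theorem tendsto_fwdDiff_iter_rpow (s : ℝ) (r : ℕ) :
    Tendsto (fun n : ℕ ↦ (n : ℝ) ^ (r + s) * (fwdDiff 1)^[r] (fun m : ℕ ↦ (m : ℝ) ^ (-s)) n) atTop
      (nhds ((-1) ^ r * (ascPochhammer ℝ r).eval s)) := by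
  have h := tendsto_rpow_mul_fwdDiff_iter (r := r) (p := r + s)
    (L := (-1) ^ r * (ascPochhammer ℝ r).eval s)
    (fun k x ↦ hasDerivAt_ascPochhammer_mul_rpow s k) ?_
  · simpa using h
  · refine tendsto_const_nhds.congr' ?_
    filter_upwards [eventually_gt_atTop 0] with x hx
    rw [mul_left_comm, ← rpow_add hx, add_comm s, add_neg_cancel, rpow_zero, mul_one]

theorem tendsto_fwdDiff_iter_rpow_zero {s p : ℝ} {r : ℕ} (h : p < r + s) :
    Tendsto (fun n : ℕ ↦ (n : ℝ) ^ p * (fwdDiff 1)^[r] (fun m : ℕ ↦ (m : ℝ) ^ (-s)) n) atTop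
      (nhds 0) := by
  have h1 := ((tendsto_rpow_neg_atTop (sub_pos.mpr h)).comp tendsto_natCast_atTop_atTop).mul
    (tendsto_fwdDiff_iter_rpow s r)
  rw [zero_mul] at h1
  refine h1.congr' ?_
  filter_upwards [eventually_gt_atTop 0] with n hn
  rw [Function.comp_apply, ← mul_assoc, ← rpow_add (by positivity)]
  congr 2
  ring

theorem tendsto_fwdDiff_iter_log_mul_rpow {p : ℝ} {r : ℕ} (h : p < r + 1) :
    Tendsto (fun n : ℕ ↦ (n : ℝ) ^ p * (fwdDiff 1)^[r] (fun m : ℕ ↦ log m * (m : ℝ) ^ (-1 : ℝ)) n)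
      atTop (nhds 0) := by
  have h1 := tendsto_rpow_mul_fwdDiff_iter (r := r) (p := p) (L := 0)
    (fun k x ↦ hasDerivAt_log_sub_harmonic_mul_rpow k) ?_
  · simpa using h1
  · have h2 := (isLittleO_log_rpow_atTop (sub_pos.mpr h)).tendsto_div_nhds_zero.sub
      ((tendsto_rpow_neg_atTop (sub_pos.mpr h)).const_mul (harmonic r : ℝ))
    have h3 := h2.const_mul ((-1) ^ r * (r.factorial : ℝ))
    rw [mul_zero, sub_zero, mul_zero] at h3
    refine h3.congr' ?_
    filter_upwards [eventually_gt_atTop 0] with x hx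
    rw [div_eq_mul_inv, ← rpow_neg hx.le, ← sub_mul,
      show -(r + 1 - p) = p + -(1 + r) by ring, rpow_add hx]
    ring

theorem tendsto_rpow_mul_exp_neg_mul_sqrt (q : ℝ) {b : ℝ} (hb : 0 < b) :
    Tendsto (fun n : ℕ ↦ (n : ℝ) ^ q * rexp (-b * √n)) atTop (nhds 0) := by
  refine ((tendsto_rpow_mul_exp_neg_mul_atTop_nhds_zero (2 * q) b hb).comp
    (tendsto_sqrt_atTop.comp tendsto_natCast_atTop_atTop)).congr fun n ↦ ?_
  simp only [Function.comp_apply]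
  rw [rpow_mul (sqrt_nonneg _), rpow_two, sq_sqrt n.cast_nonneg]

theorem abs_log_le_two_mul_abs_sub_one {x : ℝ} (h : |x - 1| ≤ 1 / 2) :
    |log x| ≤ 2 * |x - 1| := by
  have h1 := abs_log_sub_add_sum_range_le (x := 1 - x) (by rw [abs_sub_comm]; linarith) 0
  rw [Finset.sum_range_zero, zero_add, zero_add, pow_one, sub_sub_cancel, abs_sub_comm] at h1
  refine h1.trans ?_
  rw [div_le_iff₀ (by linarith)]
  nlinarith [abs_nonneg (x - 1)]

/-- The part of the asymptotic expansion of `log (r_α n)` that is not negligible after `r`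
differences. -/
noncomputable def logRseqExpansion (α : ℝ) (r n : ℕ) : ℝ :=
  π * (n : ℝ) ^ (-(1 / 2) : ℝ) - log 8 * (n : ℝ) ^ (-1 : ℝ) -
    (1 + α) * (log n * (n : ℝ) ^ (-1 : ℝ)) -
    ∑ i ∈ Finset.range (2 * r), (π ^ (i + 1) * (i + 1))⁻¹ * (n : ℝ) ^ (-(1 + (i + 1) / 2) : ℝ)

theorem exists_abs_log_pbar_sub_le : ∃ C : ℝ, ∀ᶠ n : ℕ in atTop, 0 < pbar n ∧
    |log (pbar n) - (π * √n - log 8 - log n + log (1 - 1 / (π * √n)))| ≤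
      C * (n * rexp (-(π - 3.1) * √n)) := by
  obtain ⟨C, h⟩ := exists_abs_pbar_sub_le
  have hb : 0 < π - 3.1 := by linarith [pi_gt_d2]
  have ht := (tendsto_rpow_mul_exp_neg_mul_sqrt 1 hb).const_mul (16 * C)
  rw [mul_zero] at ht
  refine ⟨2 * (16 * C), ?_⟩
  filter_upwards [h, ht.eventually_le_const (show (0 : ℝ) < 1 / 2 by norm_num),
    eventually_ge_atTop 1] with n hn hs hn1
  rw [rpow_one] at hs
  have hn1' : (1 : ℝ) ≤ n := by exact_mod_cast hn1
  have hn0 : (0 : ℝ) < n := by linarith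
  have hs1 : 1 ≤ √n := one_le_sqrt.mpr hn1'
  have hs0 : 0 < √n := by linarith
  have hu : 1 / (π * √n) ≤ 1 / 2 := by
    rw [div_le_div_iff₀ (by positivity) (by norm_num)]
    nlinarith [pi_gt_three]
  set B := rexp (π * √n) / (8 * n) * (1 - 1 / (π * √n)) with hB
  have hB0 : 0 < B := mul_pos (by positivity) (by linarith)
  have hBle : rexp (π * √n) / (16 * n) ≤ B := by
    calc rexp (π * √n) / (16 * n) = rexp (π * √n) / (8 * n) * (1 / 2) := by
          field_simp
          norm_num
      _ ≤ B := by
        rw [hB]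
        gcongr
        linarith
  have hδ : |pbar n / B - 1| ≤ 16 * C * (n * rexp (-(π - 3.1) * √n)) := by
    rw [div_sub_one hB0.ne', abs_div, abs_of_pos hB0, div_le_iff₀ hB0]
    refine hn.trans ?_
    have hC : 0 ≤ C := nonneg_of_mul_nonneg_left ((abs_nonneg _).trans hn) (exp_pos _)
    calc C * rexp (3.1 * √n) = 16 * C * (n * rexp (-(π - 3.1) * √n)) *
          (rexp (π * √n) / (16 * n)) := by
          rw [show 3.1 * √(n : ℝ) = -(π - 3.1) * √n + π * √n by ring, exp_add]
          field_simp
      _ ≤ _ := by gcongr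
  have hlB : log B = π * √n - log 8 - log n + log (1 - 1 / (π * √n)) := by
    rw [hB, log_mul (by positivity) (by linarith), log_div (by positivity) (by positivity),
      log_exp, log_mul (by norm_num) hn0.ne']
    ring
  have hp : (0 : ℝ) < pbar n := by
    have h1 := (abs_le.mp (hδ.trans hs)).1
    have h2 : 0 < pbar n / B := by linarith
    exact (div_pos_iff_of_pos_right hB0).mp h2
  refine ⟨by exact_mod_cast hp, ?_⟩
  rw [← hlB, ← log_div hp.ne' hB0.ne', mul_assoc]
  exact (abs_log_le_two_mul_abs_sub_one (hδ.trans hs)).trans (by linarith)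

theorem tendsto_rpow_mul_log_rseq_sub (α : ℝ) (r : ℕ) :
    Tendsto (fun n : ℕ ↦ (n : ℝ) ^ (r + 1 / 2 : ℝ) *
      (log (rseq α n) - logRseqExpansion α r n)) atTop (nhds 0) := by
  obtain ⟨C, h⟩ := exists_abs_log_pbar_sub_le
  have hb : 0 < π - 3.1 := by linarith [pi_gt_d2]
  have ht := ((tendsto_rpow_mul_exp_neg_mul_sqrt (r + 1 / 2) hb).const_mul C).add
    (tendsto_natCast_atTop_atTop.const_div_atTop (2 : ℝ))
  rw [mul_zero, zero_add] at ht
  refine squeeze_zero_norm' ?_ ht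
  filter_upwards [h, eventually_ge_atTop 1] with n ⟨hp, hn⟩ hn1
  have hn1' : (1 : ℝ) ≤ n := by exact_mod_cast hn1
  have hn0 : (0 : ℝ) < n := by linarith
  have hs1 : 1 ≤ √n := one_le_sqrt.mpr hn1'
  have hs0 : 0 < √n := by linarith
  have hss : √(n : ℝ) * √n = n := mul_self_sqrt hn0.le
  set u := 1 / (π * √n) with hu
  have hu0 : 0 < u := by positivity
  have hu2 : u ≤ 1 / 2 := by
    rw [hu, div_le_div_iff₀ (by positivity) (by norm_num)]
    nlinarith [pi_gt_three]
  have hus : u ≤ (√n)⁻¹ := by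
    rw [hu, one_div]
    gcongr
    nlinarith [pi_gt_three]
  have hpow (i : ℕ) : (n : ℝ) ^ (-(1 + (i + 1) / 2) : ℝ) = (n : ℝ)⁻¹ * ((√n)⁻¹) ^ (i + 1) := by
    rw [neg_add, rpow_add hn0, rpow_neg_one, inv_pow, rpow_neg hn0.le, sqrt_eq_rpow,
      ← rpow_natCast, ← rpow_mul hn0.le]
    congr 3
    push_cast
    ring
  have hhalf : (n : ℝ) ^ (-(1 / 2) : ℝ) = (n : ℝ)⁻¹ * √n := by
    rw [rpow_neg hn0.le, ← sqrt_eq_rpow]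
    nth_rw 2 [← hss]
    field_simp
  have hp' : (0 : ℝ) < pbar n := by exact_mod_cast hp
  have hlog : log (rseq α n) = (n : ℝ)⁻¹ * (log (pbar n) - α * log n) := by
    rw [rseq, log_rpow (by positivity), log_div hp'.ne' (by positivity), log_rpow hn0]
  have hsum : ∑ i ∈ Finset.range (2 * r), (π ^ (i + 1) * (i + 1))⁻¹ *
      (n : ℝ) ^ (-(1 + (i + 1) / 2) : ℝ) =
      (n : ℝ)⁻¹ * ∑ i ∈ Finset.range (2 * r), u ^ (i + 1) / (i + 1) := by
    rw [Finset.mul_sum]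
    refine Finset.sum_congr rfl fun i _ ↦ ?_
    rw [hpow, hu, one_div, mul_inv π, mul_pow, mul_inv, ← inv_pow]
    ring
  have htail := abs_log_sub_add_sum_range_le (x := u) (by rw [abs_of_pos hu0]; linarith) (2 * r)
  rw [abs_of_pos hu0] at htail
  have htail' : u ^ (2 * r + 1) / (1 - u) ≤ 2 * ((√n)⁻¹) ^ (2 * r + 1) := by
    rw [div_le_iff₀ (by linarith)]
    have h1 : u ^ (2 * r + 1) ≤ ((√n)⁻¹) ^ (2 * r + 1) := by gcongr
    have h2 : 0 ≤ ((√n)⁻¹) ^ (2 * r + 1) := by positivity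
    nlinarith
  have hhead : (n : ℝ) ^ (r + 1 / 2 : ℝ) * ((√n)⁻¹) ^ (2 * r + 1) = 1 := by
    rw [sqrt_eq_rpow, inv_pow, ← rpow_natCast, ← rpow_mul hn0.le,
      show (1 / 2 : ℝ) * (2 * r + 1 : ℕ) = r + 1 / 2 by push_cast; ring]
    exact mul_inv_cancel₀ (by positivity)
  have hkey : log (rseq α n) - logRseqExpansion α r n =
      (n : ℝ)⁻¹ * ((log (pbar n) - (π * √n - log 8 - log n + log (1 - u))) +
        (∑ i ∈ Finset.range (2 * r), u ^ (i + 1) / (i + 1) + log (1 - u))) := by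
    rw [logRseqExpansion, hsum, hlog, hhalf, rpow_neg_one]
    ring
  rw [hkey, norm_mul, norm_mul, norm_inv, norm_of_nonneg hn0.le, norm_of_nonneg (by positivity),
    norm_eq_abs]
  calc _ ≤ (n : ℝ) ^ (r + 1 / 2 : ℝ) * ((n : ℝ)⁻¹ * (C * (n * rexp (-(π - 3.1) * √n)) +
        2 * ((√n)⁻¹) ^ (2 * r + 1))) := by
        gcongr
        exact (abs_add_le _ _).trans (add_le_add hn (htail.trans htail'))
    _ = C * ((n : ℝ) ^ (r + 1 / 2 : ℝ) * rexp (-(π - 3.1) * √n)) +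
        2 / n * ((n : ℝ) ^ (r + 1 / 2 : ℝ) * ((√n)⁻¹) ^ (2 * r + 1)) := by
        field_simp
    _ = _ := by rw [hhead, mul_one]

theorem tendsto_fwdDiff_iter_logRseqExpansion (α : ℝ) (r : ℕ) :
    Tendsto (fun n : ℕ ↦ (n : ℝ) ^ (r + 1 / 2 : ℝ) * (fwdDiff 1)^[r] (logRseqExpansion α r) n)
      atTop (nhds (π * ((-1) ^ r * (ascPochhammer ℝ r).eval (1 / 2)))) := by
  have hE : logRseqExpansion α r = π • (fun n : ℕ ↦ (n : ℝ) ^ (-(1 / 2) : ℝ)) +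
      ((-log 8) • (fun n : ℕ ↦ (n : ℝ) ^ (-1 : ℝ)) +
      ((-(1 + α)) • (fun n : ℕ ↦ log n * (n : ℝ) ^ (-1 : ℝ)) +
      ∑ i ∈ Finset.range (2 * r), (-(π ^ (i + 1) * (i + 1))⁻¹) •
        (fun n : ℕ ↦ (n : ℝ) ^ (-(1 + (i + 1) / 2) : ℝ)))) := by
    ext n
    simp only [logRseqExpansion, Pi.add_apply, Pi.smul_apply, smul_eq_mul, Finset.sum_apply,
      neg_mul, Finset.sum_neg_distrib]
    ring
  have h1 := (tendsto_fwdDiff_iter_rpow (1 / 2) r).const_mul π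
  have h2 := (tendsto_fwdDiff_iter_rpow_zero (s := 1) (p := r + 1 / 2) (r := r)
    (by linarith)).const_mul (-log 8)
  have h3 := (tendsto_fwdDiff_iter_log_mul_rpow (p := r + 1 / 2) (r := r)
    (by linarith)).const_mul (-(1 + α))
  have h4 := tendsto_finsetSum (Finset.range (2 * r)) fun i _ ↦
    (tendsto_fwdDiff_iter_rpow_zero (s := 1 + (i + 1) / 2) (p := r + 1 / 2) (r := r)
      (by linarith [i.cast_nonneg (α := ℝ)])).const_mul (-(π ^ (i + 1) * ((i : ℝ) + 1))⁻¹)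
  have h := h1.add (h2.add (h3.add h4))
  simp only [mul_zero, Finset.sum_const_zero, add_zero] at h
  refine h.congr fun n ↦ ?_
  rw [hE]
  simp only [fwdDiff_iter_add, fwdDiff_iter_const_smul, fwdDiff_iter_finsetSum, Pi.add_apply,
    Pi.smul_apply, smul_eq_mul, Finset.sum_apply, mul_add, Finset.mul_sum, mul_left_comm]

theorem fdiff_eq_fwdDiff : fdiff = fwdDiff 1 := rfl

end Overpartition

theorem stmt1 (r : ℕ) (hr : 2 ≤ r) (α : ℝ) (hα : 0 ≤ α) :
    Tendsto
      (fun n : ℕ =>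
        (n : ℝ) ^ ((r : ℝ) + 1/2) * ((-1 : ℝ) ^ r * (fdiff^[r] (fun m => Real.log (rseq α m))) n))
      atTop (nhds (π * (ascPochhammer ℝ r).eval (1/2 : ℝ))) := by
  have h := ((Overpartition.tendsto_fwdDiff_iter_logRseqExpansion α r).add
    (Overpartition.tendsto_rpow_mul_fwdDiff_iter_zero (by positivity)
      (Overpartition.tendsto_rpow_mul_log_rseq_sub α r) r)).const_mul ((-1) ^ r)
  have hsq : (-1 : ℝ) ^ r * (-1) ^ r = 1 := by rw [← mul_pow]; norm_num
  rw [add_zero, mul_left_comm, ← mul_assoc ((-1) ^ r), hsq, one_mul] at h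
  refine h.congr fun n ↦ ?_
  have hlog : (fun m ↦ log (rseq α m)) = Overpartition.logRseqExpansion α r +
      fun m ↦ log (rseq α m) - Overpartition.logRseqExpansion α r m := by
    ext m
    simp
  rw [Overpartition.fdiff_eq_fwdDiff, hlog, fwdDiff_iter_add, Pi.add_apply]
  ring
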